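/- Let R = K[a] be the polynomial algebra over an algebraically closed field K of characteristic 0, π the automorphism with π(a) = κa + χ (κ ≠ 0), and p ∈ K[a] a nonzero polynomial. The generalized Weyl algebra R(π,p) is homologically smooth (admits a finitely generated projective resolution of finite length as a bimodule over itself) of homological dimension 2 if and only if p has no multiple roots. -/

import Mathlib

open TensorProduct

universe u v

/-- The algebra `B` admits, as a bimodule over itself (i.e. as a module over its enveloping
algebra `B ⊗[R] Bᵐᵒᵖ`), a resolution of length `n` by finitely generated projective
modules. -/
def HasFGProjBimoduleResolutionOfLength (R : Type u) [CommRing R]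
    (B : Type v) [Ring B] [Algebra R B] (n : ℕ) : Prop :=
  letI : Module (B ⊗[R] Bᵐᵒᵖ) B := TensorProduct.Algebra.module
  ∃ (P : ℕ → ModuleCat.{max u v} (B ⊗[R] Bᵐᵒᵖ))
    (d : ∀ i : ℕ, P (i + 1) →ₗ[B ⊗[R] Bᵐᵒᵖ] P i)
    (ε : P 0 →ₗ[B ⊗[R] Bᵐᵒᵖ] B),
      (∀ i, Module.Finite (B ⊗[R] Bᵐᵒᵖ) (P i)) ∧
      (∀ i, Module.Projective (B ⊗[R] Bᵐᵒᵖ) (P i)) ∧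
      Function.Surjective ε ∧
      Function.Exact (d 0) ε ∧
      (∀ i, Function.Exact (d (i + 1)) (d i)) ∧
      (∀ i, n < i → Subsingleton (P i))

/-- `B` is homologically smooth: as a bimodule over itself it admits a finitely generated
projective resolution of finite length. -/
def HomologicallySmooth (R : Type u) [CommRing R]
    (B : Type v) [Ring B] [Algebra R B] : Prop :=
  ∃ n : ℕ, HasFGProjBimoduleResolutionOfLength R B n

/-- The defining relations of the degree-one generalized Weyl algebra `K[a](π, p)` with
`π(a) = κ a + χ`; the generators `0`, `1`, `2` of the free algebra are `a`, `x₊`, `x₋`. -/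
inductive GWARel (K : Type*) [Field K] (κ χ : K) (p : Polynomial K) :
    FreeAlgebra K (Fin 3) → FreeAlgebra K (Fin 3) → Prop
  | minus_plus : GWARel K κ χ p (FreeAlgebra.ι K 2 * FreeAlgebra.ι K 1)
      (Polynomial.aeval (FreeAlgebra.ι K 0) p)
  | plus_minus : GWARel K κ χ p (FreeAlgebra.ι K 1 * FreeAlgebra.ι K 2)
      (Polynomial.aeval (κ • FreeAlgebra.ι K 0 + algebraMap K _ χ) p)
  | plus_a : GWARel K κ χ p (FreeAlgebra.ι K 1 * FreeAlgebra.ι K 0)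
      ((κ • FreeAlgebra.ι K 0 + algebraMap K _ χ) * FreeAlgebra.ι K 1)
  | minus_a : GWARel K κ χ p (FreeAlgebra.ι K 2 * FreeAlgebra.ι K 0)
      ((κ⁻¹ • (FreeAlgebra.ι K 0 - algebraMap K _ χ)) * FreeAlgebra.ι K 2)

/-- The degree-one generalized Weyl algebra `K[a](π, p)`, `π(a) = κ a + χ`. -/
def GeneralizedWeylAlgebra (K : Type*) [Field K] (κ χ : K) (p : Polynomial K) : Type _ :=
  RingQuot (GWARel K κ χ p)

noncomputable instance (K : Type*) [Field K] (κ χ : K) (p : Polynomial K) :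
    Ring (GeneralizedWeylAlgebra K κ χ p) :=
  inferInstanceAs (Ring (RingQuot (GWARel K κ χ p)))

noncomputable instance (K : Type*) [Field K] (κ χ : K) (p : Polynomial K) :
    Algebra K (GeneralizedWeylAlgebra K κ χ p) :=
  inferInstanceAs (Algebra K (RingQuot (GWARel K κ χ p)))

namespace GWAProof

section Homological

open CategoryTheory

universe w

variable {S : Type w} [Ring S]

theorem pdLT_ker_iff {P M : Type w} [AddCommGroup P] [Module S P] [AddCommGroup M] [Module S M]
    [Module.Projective S P] (f : P →ₗ[S] M) (hf : Function.Surjective f) (n : ℕ) :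
    HasProjectiveDimensionLT (ModuleCat.of S M) (n + 2) ↔
      HasProjectiveDimensionLT (ModuleCat.of S (LinearMap.ker f)) (n + 1) := by
  let C : ShortComplex (ModuleCat.{w} S) :=
    ShortComplex.mk (ModuleCat.ofHom (LinearMap.ker f).subtype) (ModuleCat.ofHom f)
      (by ext x; exact x.2)
  have hC : C.ShortExact := by
    refine ShortComplex.ShortExact.mk' ?_ ?_ ?_
    · rw [ShortComplex.moduleCat_exact_iff]
      intro x hx
      exact ⟨⟨x, hx⟩, rfl⟩
    · rw [ModuleCat.mono_iff_injective]
      exact Subtype.val_injective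
    · rw [ModuleCat.epi_iff_surjective]
      exact hf
  have h2 : Projective C.X₂ := (IsProjective.iff_projective (R := S) P).1 inferInstance
  exact hC.hasProjectiveDimensionLT_X₃_iff n h2

theorem pdLT_one_iff {M : Type w} [AddCommGroup M] [Module S M] :
    HasProjectiveDimensionLT (ModuleCat.of S M) 1 ↔ Module.Projective S M := by
  rw [← projective_iff_hasProjectiveDimensionLT_one, ← IsProjective.iff_projective]

theorem pdLT_of_res (n : ℕ) : ∀ (M : Type w) [AddCommGroup M] [Module S M]
    (P : ℕ → ModuleCat.{w} S) (d : ∀ i : ℕ, P (i + 1) →ₗ[S] P i) (ε : P 0 →ₗ[S] M)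
    (_ : ∀ i, Module.Projective S (P i)) (_ : Function.Surjective ε)
    (_ : Function.Exact (d 0) ε) (_ : ∀ i, Function.Exact (d (i + 1)) (d i))
    (_ : ∀ i, n < i → Subsingleton (P i)),
    HasProjectiveDimensionLT (ModuleCat.of S M) (n + 1) := by
  induction n with
  | zero =>
    intro M _ _ P d ε hP hε h0 h hs
    rw [pdLT_one_iff]
    have hinj : Function.Injective ε := by
      rw [injective_iff_map_eq_zero]
      intro x hx
      obtain ⟨y, rfl⟩ := (h0 x).1 hx
      have := hs 1 (by norm_num)
      rw [Subsingleton.elim y 0, map_zero]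
    exact Module.Projective.of_equiv (LinearEquiv.ofBijective ε ⟨hinj, hε⟩)
  | succ n ih =>
    intro M _ _ P d ε hP hε h0 h hs
    rw [pdLT_ker_iff ε hε]
    let ε' : P 1 →ₗ[S] LinearMap.ker ε :=
      (d 0).codRestrict _ (fun x => (h0 _).2 ⟨x, rfl⟩)
    refine ih _ (fun i => P (i + 1)) (fun i => d (i + 1)) ε' (fun i => hP _) ?_ ?_
      (fun i => h _) (fun i hi => hs _ (by omega))
    · rintro ⟨y, hy⟩
      obtain ⟨x, rfl⟩ := (h0 y).1 hy
      exact ⟨x, rfl⟩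
    · intro x
      rw [← h 0 x]
      exact Subtype.ext_iff

/-- A map out of the source of `f` which kills the kernel factors through the range. -/
theorem exists_factor {M N L : Type*} [AddCommGroup M] [Module S M] [AddCommGroup N] [Module S N]
    [AddCommGroup L] [Module S L] (f : M →ₗ[S] N) (g : M →ₗ[S] L)
    (h : ∀ v, f v = 0 → g v = 0) :
    ∃ s : LinearMap.range f →ₗ[S] L, ∀ v, s (f.rangeRestrict v) = g v := by
  refine ⟨((LinearMap.ker f).liftQ g (fun v hv => h v hv)).comp
    f.quotKerEquivRange.symm.toLinearMap, fun v => ?_⟩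
  have : f.quotKerEquivRange.symm (f.rangeRestrict v) = (LinearMap.ker f).mkQ v := by
    rw [LinearEquiv.symm_apply_eq]
    rfl
  simp only [LinearMap.comp_apply, LinearEquiv.coe_coe, this]
  exact Submodule.liftQ_apply _ _ _

end Homological


section Abstract


/-- The abstract configuration in which the second syzygy is computed. -/
structure Cfg (S T : Type*) [Ring S] [CommRing T] where
  ev : T →+* S
  π₁ : T →+* T
  π₂ : T →+* T
  comm : ∀ h, π₁ (π₂ h) = π₂ (π₁ h)
  x : S
  y : S
  x' : S
  y' : S
  k : S
  hx : ∀ h, x * ev h = ev (π₁ h) * x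
  hy : ∀ h, y * ev (π₁ h) = ev h * y
  hx' : ∀ h, x' * ev (π₂ h) = ev h * x'
  hy' : ∀ h, y' * ev h = ev (π₂ h) * y'
  xx' : x * x' = x' * x
  xy' : x * y' = y' * x
  yx' : y * x' = x' * y
  yy' : y * y' = y' * y
  P1 : T
  P2 : T
  d : T
  q : T
  hP1 : π₂ P1 = P1
  hP2 : π₁ P2 = P2
  hq : P1 - P2 = d * q
  hyx : y * x = ev P1
  hxy : x * y = ev (π₁ P1)
  hxy_opp : x' * y' = ev P2
  hyx_opp : y' * x' = ev (π₂ P2)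
  hk : ev (π₁ (π₂ d)) = k * ev d

namespace Cfg

variable {S T : Type*} [Ring S] [CommRing T] (c : Cfg S T)

theorem q0t : c.ev c.q * c.ev c.d = c.y * c.x - c.x' * c.y' := by
  rw [c.hyx, c.hxy_opp, ← map_sub, c.hq, ← map_mul, mul_comm]

theorem qpt : c.ev (c.π₁ c.q) * c.ev (c.π₁ c.d) = c.x * c.y - c.x' * c.y' := by
  have h : c.π₁ c.P1 - c.P2 = c.π₁ c.q * c.π₁ c.d := by
    rw [← map_mul, mul_comm, ← c.hq, map_sub, c.hP2]
  rw [c.hxy, c.hxy_opp, ← map_sub, h, map_mul]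

theorem qmt : c.ev (c.π₂ c.q) * c.ev (c.π₂ c.d) = c.y * c.x - c.y' * c.x' := by
  have h : c.P1 - c.π₂ c.P2 = c.π₂ c.q * c.π₂ c.d := by
    rw [← map_mul, mul_comm, ← c.hq, map_sub, c.hP1]
  rw [c.hyx, c.hyx_opp, ← map_sub, h, map_mul]

theorem q2t : c.ev (c.π₁ (c.π₂ c.q)) * c.ev (c.π₁ (c.π₂ c.d)) = c.x * c.y - c.y' * c.x' := by
  have h : c.π₁ c.P1 - c.π₂ c.P2 = c.π₁ (c.π₂ c.q) * c.π₁ (c.π₂ c.d) := by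
    rw [← map_mul, ← map_mul, mul_comm, ← c.hq, map_sub, map_sub, c.hP1, c.comm, c.hP2]
  rw [c.hxy, c.hyx_opp, ← map_sub, h, map_mul]

/-- The map `S⁴ → S³` whose image is the second syzygy. -/
def D : (S × S × S × S) →ₗ[S] (S × S × S) where
  toFun v := (- (v.1 * (c.x - c.x' * c.k)) - v.2.1 * (c.y * c.k - c.y') - v.2.2.1 * c.ev c.q
      - v.2.2.2 * (c.ev (c.π₁ (c.π₂ c.q)) * c.k),
    v.1 * c.ev (c.π₁ c.d) + v.2.2.1 * c.y + v.2.2.2 * c.y',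
    v.2.1 * c.ev (c.π₂ c.d) + v.2.2.1 * c.x' + v.2.2.2 * c.x)
  map_add' v w := by
    ext <;> simp only [Prod.fst_add, Prod.snd_add] <;> first | noncomm_ring | simp
  map_smul' r v := by
    ext <;> simp only [Prod.smul_fst, Prod.smul_snd, smul_eq_mul, RingHom.id_apply] <;> first | noncomm_ring | simp

/-- The map `S³ → S`. -/
def d₁ : (S × S × S) →ₗ[S] S where
  toFun v := v.1 * c.ev c.d + v.2.1 * (c.x - c.x') + v.2.2 * (c.y - c.y')
  map_add' v w := by
    simp only [Prod.fst_add, Prod.snd_add]; noncomm_ring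
  map_smul' r v := by
    simp only [Prod.smul_fst, Prod.smul_snd, smul_eq_mul, RingHom.id_apply]; noncomm_ring

theorem d₁_D (v : S × S × S × S) : c.d₁ (c.D v) = 0 := by
  obtain ⟨v1, v2, v3, v4⟩ := v
  simp only [d₁, D, LinearMap.coe_mk, AddHom.coe_mk]
  have e1 : c.ev (c.π₁ c.d) * c.x = c.x * c.ev c.d := (c.hx _).symm
  have e2 : c.ev (c.π₁ c.d) * c.x' = c.x' * (c.k * c.ev c.d) := by
    rw [← c.hk, c.comm, c.hx']
  have e3 : c.ev (c.π₂ c.d) * c.y' = c.y' * c.ev c.d := (c.hy' _).symm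
  have e4 : c.ev (c.π₂ c.d) * c.y = c.y * (c.k * c.ev c.d) := by
    rw [← c.hk, c.hy]
  have e5 := c.q0t
  have e6 := c.q2t
  rw [c.hk] at e6
  linear_combination (norm := noncomm_ring) v1 * e1 - v1 * e2 - v2 * e3 + v2 * e4 - v3 * e5
    - v4 * e6 - v3 * c.yx' - v4 * c.xy'

def θ (h : T) : (S × S × S × S) →ₗ[S] (S × S × S × S) where
  toFun v := (v.1 * c.ev (c.π₁ h), v.2.1 * c.ev (c.π₂ h), v.2.2.1 * c.ev h,
    v.2.2.2 * c.ev (c.π₁ (c.π₂ h)))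
  map_add' v w := by
    ext <;> simp only [Prod.fst_add, Prod.snd_add] <;> first | noncomm_ring | simp
  map_smul' r v := by
    ext <;> simp only [Prod.smul_fst, Prod.smul_snd, smul_eq_mul, RingHom.id_apply] <;> first | noncomm_ring | simp

def Eq : (S × S × S × S) →ₗ[S] (S × S × S × S) where
  toFun v := (0, 0, v.1 * c.x - v.2.1 * c.y' + v.2.2.1 * c.ev c.q,
    - (v.1 * c.x') + v.2.1 * c.y + v.2.2.2 * c.ev (c.π₁ (c.π₂ c.q)))
  map_add' v w := by
    ext <;> simp only [Prod.fst_add, Prod.snd_add] <;> first | noncomm_ring | simp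
  map_smul' r v := by
    ext <;> simp only [Prod.smul_fst, Prod.smul_snd, smul_eq_mul, RingHom.id_apply] <;> first | noncomm_ring | simp

def Ed : (S × S × S × S) →ₗ[S] (S × S × S × S) where
  toFun v := (v.1 * c.ev (c.π₁ c.d) + v.2.2.1 * c.y + v.2.2.2 * c.y',
    v.2.1 * c.ev (c.π₂ c.d) + v.2.2.1 * c.x' + v.2.2.2 * c.x, 0, 0)
  map_add' v w := by
    ext <;> simp only [Prod.fst_add, Prod.snd_add] <;> first | noncomm_ring | simp
  map_smul' r v := by
    ext <;> simp only [Prod.smul_fst, Prod.smul_snd, smul_eq_mul, RingHom.id_apply] <;> first | noncomm_ring | simp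

def Ep : (S × S × S × S) →ₗ[S] (S × S × S × S) where
  toFun v := (v.1 * c.ev (c.π₁ c.P1) - v.2.1 * (c.y * c.y') + v.2.2.1 * (c.y * c.ev (c.π₁ c.q)),
    0, 0, v.2.1 * (c.ev (c.π₂ c.d) * c.y) + v.2.2.1 * (c.x' * c.y) + v.2.2.2 * (c.x * c.y))
  map_add' v w := by
    ext <;> simp only [Prod.fst_add, Prod.snd_add] <;> first | noncomm_ring | simp
  map_smul' r v := by
    ext <;> simp only [Prod.smul_fst, Prod.smul_snd, smul_eq_mul, RingHom.id_apply] <;> first | noncomm_ring | simp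

theorem D_Eq (v : S × S × S × S) : (c.D (c.Eq v)).2 = (c.D (c.θ c.q v)).2 := by
  obtain ⟨v1, v2, v3, v4⟩ := v
  simp only [D, Eq, θ, LinearMap.coe_mk, AddHom.coe_mk]
  have e1 := c.qpt
  have e2 := c.qmt
  ext
  · linear_combination (norm := noncomm_ring) -v1 * e1 + v2 * c.yy'
  · linear_combination (norm := noncomm_ring) -v2 * e2 + v1 * c.xx'

theorem D_Ed (v : S × S × S × S) : (c.D (c.Ed v)).2 = (c.D (c.θ c.d v)).2 := by
  obtain ⟨v1, v2, v3, v4⟩ := v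
  simp only [D, Ed, θ, LinearMap.coe_mk, AddHom.coe_mk]
  have e1 := c.hy c.d
  have e2 := c.hy' (c.π₁ c.d)
  have e3 := c.hx' c.d
  have e4 := c.hx (c.π₂ c.d)
  rw [← c.comm] at e2
  ext
  · linear_combination (norm := noncomm_ring) v3 * e1 + v4 * e2
  · linear_combination (norm := noncomm_ring) v3 * e3 + v4 * e4

theorem D_Ep (v : S × S × S × S) : (c.D (c.Ep v)).2 = (c.D (c.θ c.P1 v)).2 := by
  obtain ⟨v1, v2, v3, v4⟩ := v
  simp only [D, Ep, θ, LinearMap.coe_mk, AddHom.coe_mk]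
  rw [c.hP1, ← c.hxy, ← c.hyx]
  have e1 := c.qpt
  have e2 : c.ev (c.π₂ c.d) * c.y = c.y * c.ev (c.π₁ (c.π₂ c.d)) := (c.hy _).symm
  have e3 := c.hy' (c.π₁ c.d)
  rw [← c.comm] at e3
  have e5 : c.y * c.x * c.ev (c.π₂ c.d) = c.ev (c.π₂ c.d) * (c.y * c.x) := by
    rw [c.hyx, ← map_mul, ← map_mul, mul_comm]
  ext
  · linear_combination (norm := noncomm_ring) v3 * c.y * e1 - v2 * c.y * e3 + v2 * e2 * c.y'
      - v3 * c.yx' * c.y'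
  · linear_combination (norm := noncomm_ring) -v2 * e5 - v3 * c.yx' * c.x - v3 * c.y * c.xx'

theorem θ_comp (g h : T) (v : S × S × S × S) : c.θ g (c.θ h v) = c.θ (g * h) v := by
  obtain ⟨v1, v2, v3, v4⟩ := v
  have hc : ∀ a b : T, c.ev a * c.ev b = c.ev b * c.ev a := fun a b => by
    rw [← map_mul, mul_comm, map_mul]
  simp only [θ, LinearMap.coe_mk, AddHom.coe_mk, map_mul, mul_assoc]
  rw [hc (c.π₁ h), hc (c.π₂ h), hc h, hc (c.π₁ (c.π₂ h))]

theorem θ_add (g h : T) (v : S × S × S × S) : c.θ (g + h) v = c.θ g v + c.θ h v := by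
  obtain ⟨v1, v2, v3, v4⟩ := v
  simp [θ, mul_add]

theorem θ_one (v : S × S × S × S) : c.θ 1 v = v := by
  obtain ⟨v1, v2, v3, v4⟩ := v
  simp [θ]

/-- The idempotent `S⁴ → S⁴`. -/
def E (h1 h2 h3 : T) : (S × S × S × S) →ₗ[S] (S × S × S × S) :=
  c.Eq ∘ₗ c.θ h1 + c.Ep ∘ₗ c.θ h2 + c.Ed ∘ₗ c.θ h3

theorem D_E {h1 h2 h3 : T} (h : c.q * h1 + c.P1 * h2 + c.d * h3 = 1)
    (ht0 : ∀ v : S, v * c.ev c.d = 0 → v = 0) (v : S × S × S × S) :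
    c.D (c.E h1 h2 h3 v) = c.D v := by
  have h2' : (c.D (c.E h1 h2 h3 v)).2 = (c.D v).2 := by
    have : c.D (c.θ (c.q * h1 + c.P1 * h2 + c.d * h3) v) = c.D v := by rw [h, c.θ_one]
    rw [← this]
    simp only [E, LinearMap.add_apply, LinearMap.comp_apply, map_add, Prod.snd_add, D_Eq, D_Ep,
      D_Ed, θ_comp, θ_add]
  have e1 := c.d₁_D (c.E h1 h2 h3 v)
  have e2 := c.d₁_D v
  refine Prod.ext ?_ h2'
  rw [← sub_eq_zero]
  apply ht0
  simp only [d₁, LinearMap.coe_mk, AddHom.coe_mk] at e1 e2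
  rw [h2'] at e1
  linear_combination (norm := noncomm_ring) e1 - e2

theorem D_θ {v : S × S × S × S} (hv : (c.D v).2 = 0) (h : T) : (c.D (c.θ h v)).2 = 0 := by
  obtain ⟨v1, v2, v3, v4⟩ := v
  rw [Prod.ext_iff] at hv
  simp only [D, θ, LinearMap.coe_mk, AddHom.coe_mk, Prod.fst_zero, Prod.snd_zero] at hv ⊢
  obtain ⟨hA, hB⟩ := hv
  have hc : ∀ a b : T, c.ev a * c.ev b = c.ev b * c.ev a := fun a b => by
    rw [← map_mul, mul_comm, map_mul]
  have e2 := c.hy' (c.π₁ h)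
  rw [← c.comm] at e2
  refine Prod.ext ?_ ?_
  · change _ = (0 : S)
    linear_combination (norm := noncomm_ring) hA * c.ev (c.π₁ h) + v1 * hc (c.π₁ h) (c.π₁ c.d)
      - v3 * c.hy h - v4 * e2
  · change _ = (0 : S)
    linear_combination (norm := noncomm_ring) hB * c.ev (c.π₂ h) + v2 * hc (c.π₂ h) (c.π₂ c.d)
      - v3 * c.hx' h - v4 * c.hx (c.π₂ h)

theorem ker_E {h1 h2 h3 : T} (ht0 : ∀ v : S, v * c.ev c.d = 0 → v = 0)
    (htp : ∀ v : S, v * c.ev (c.π₁ c.d) = 0 → v = 0)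
    (ht2 : ∀ v : S, v * c.ev (c.π₁ (c.π₂ c.d)) = 0 → v = 0)
    (v : S × S × S × S) (hv : c.D v = 0) : c.E h1 h2 h3 v = 0 := by
  have hv2 : (c.D v).2 = 0 := by rw [hv]; rfl
  have key : ∀ v : S × S × S × S, (c.D v).2 = 0 → c.Eq v = 0 ∧ c.Ep v = 0 ∧ c.Ed v = 0 := by
    rintro ⟨v1, v2, v3, v4⟩ hv
    rw [Prod.ext_iff] at hv
    simp only [D, LinearMap.coe_mk, AddHom.coe_mk, Prod.fst_zero, Prod.snd_zero] at hv
    obtain ⟨hA, hB⟩ := hv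
    have e1 := c.hx c.d
    have e2 := c.hy' c.d
    have e3 := c.hx' (c.π₁ c.d)
    have e4 := c.hy (c.π₂ c.d)
    rw [← c.comm] at e3
    have e5 := c.hy' (c.π₁ c.d)
    rw [← c.comm] at e5
    have q0 := c.q0t
    have q2 := c.q2t
    have qp := c.qpt
    have e6 : c.x * c.y * c.ev (c.π₁ c.d) = c.ev (c.π₁ c.d) * (c.x * c.y) := by
      rw [c.hxy, ← map_mul, ← map_mul, ← map_mul, ← map_mul, mul_comm]
    refine ⟨?_, ?_, ?_⟩
    · simp only [Eq, LinearMap.coe_mk, AddHom.coe_mk]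
      have a1 : v1 * c.x - v2 * c.y' + v3 * c.ev c.q = 0 := by
        apply ht0
        linear_combination (norm := noncomm_ring) hA * c.x - hB * c.y' + v1 * e1 - v2 * e2
          + v3 * q0 + v4 * c.xy'
      have a2 : -(v1 * c.x') + v2 * c.y + v4 * c.ev (c.π₁ (c.π₂ c.q)) = 0 := by
        apply ht2
        linear_combination (norm := noncomm_ring) hB * c.y - hA * c.x' - v1 * e3 + v2 * e4
          + v4 * q2 + v3 * c.yx'
      rw [a1, a2]; rfl
    · simp only [Ep, LinearMap.coe_mk, AddHom.coe_mk]
      have a1 : v1 * c.ev (c.π₁ c.P1) - v2 * (c.y * c.y') + v3 * (c.y * c.ev (c.π₁ c.q)) = 0 := by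
        apply htp
        rw [← c.hxy]
        linear_combination (norm := noncomm_ring) hA * (c.x * c.y) - hB * (c.y * c.y') + v1 * e6
          + v3 * c.y * qp - v2 * c.y * e5 - v2 * e4 * c.y' + v4 * c.x * c.yy'
          + v4 * c.xy' * c.y - v3 * c.yx' * c.y'
      have a2 : v2 * (c.ev (c.π₂ c.d) * c.y) + v3 * (c.x' * c.y) + v4 * (c.x * c.y) = 0 := by
        linear_combination (norm := noncomm_ring) hB * c.y
      rw [a1, a2]; rfl
    · simp only [Ed, LinearMap.coe_mk, AddHom.coe_mk]
      rw [hA, hB]; rfl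
  simp only [E, LinearMap.add_apply, LinearMap.comp_apply]
  rw [(key _ (c.D_θ hv2 h1)).1, (key _ (c.D_θ hv2 h2)).2.1, (key _ (c.D_θ hv2 h3)).2.2]
  simp

/-- The second syzygy is projective. -/
theorem exists_section {h1 h2 h3 : T} (h : c.q * h1 + c.P1 * h2 + c.d * h3 = 1)
    (ht0 : ∀ v : S, v * c.ev c.d = 0 → v = 0)
    (htp : ∀ v : S, v * c.ev (c.π₁ c.d) = 0 → v = 0)
    (ht2 : ∀ v : S, v * c.ev (c.π₁ (c.π₂ c.d)) = 0 → v = 0) :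
    ∃ s : LinearMap.range c.D →ₗ[S] (S × S × S × S),
      (∀ v, s (c.D.rangeRestrict v) = c.E h1 h2 h3 v) ∧
      c.D.rangeRestrict ∘ₗ s = LinearMap.id := by
  obtain ⟨s, hs⟩ := exists_factor c.D (c.E h1 h2 h3) (c.ker_E ht0 htp ht2)
  refine ⟨s, hs, ?_⟩
  ext1 ⟨_, v, rfl⟩
  have := hs v
  change c.D.rangeRestrict (s (c.D.rangeRestrict v)) = c.D.rangeRestrict v
  rw [this]
  exact Subtype.ext (c.D_E h ht0 v)

end Cfg

end Abstract


section Concrete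

variable {K : Type u} [Field K] {κ χ : K} {p : Polynomial K}

local notation "𝔸" => GeneralizedWeylAlgebra K κ χ p

open Polynomial

variable (K κ χ p) in
/-- The projection from the free algebra. -/
noncomputable def mk : FreeAlgebra K (Fin 3) →ₐ[K] GeneralizedWeylAlgebra K κ χ p :=
  RingQuot.mkAlgHom K (GWARel K κ χ p)

theorem mk_surjective : Function.Surjective (mk K κ χ p) := RingQuot.mkAlgHom_surjective K _

variable (K κ χ p) in
noncomputable def ga : GeneralizedWeylAlgebra K κ χ p := mk K κ χ p (FreeAlgebra.ι K 0)
variable (K κ χ p) in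
noncomputable def gx : GeneralizedWeylAlgebra K κ χ p := mk K κ χ p (FreeAlgebra.ι K 1)
variable (K κ χ p) in
noncomputable def gy : GeneralizedWeylAlgebra K κ χ p := mk K κ χ p (FreeAlgebra.ι K 2)

theorem gyx : gy K κ χ p * gx K κ χ p = aeval (ga K κ χ p) p := by
  have := RingQuot.mkAlgHom_rel K (GWARel.minus_plus (K := K) (κ := κ) (χ := χ) (p := p))
  change mk K κ χ p _ = mk K κ χ p _ at this
  rwa [map_mul, ← Polynomial.aeval_algHom_apply] at this

theorem gxy : gx K κ χ p * gy K κ χ p =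
    aeval (κ • ga K κ χ p + algebraMap K 𝔸 χ) p := by
  have := RingQuot.mkAlgHom_rel K (GWARel.plus_minus (K := K) (κ := κ) (χ := χ) (p := p))
  change mk K κ χ p _ = mk K κ χ p _ at this
  rwa [map_mul, ← Polynomial.aeval_algHom_apply, map_add, map_smul, AlgHom.commutes] at this

theorem gxa : gx K κ χ p * ga K κ χ p =
    (κ • ga K κ χ p + algebraMap K 𝔸 χ) * gx K κ χ p := by
  have := RingQuot.mkAlgHom_rel K (GWARel.plus_a (K := K) (κ := κ) (χ := χ) (p := p))
  change mk K κ χ p _ = mk K κ χ p _ at this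
  rwa [map_mul, map_mul, map_add, map_smul, AlgHom.commutes] at this

theorem gya : gy K κ χ p * ga K κ χ p =
    (κ⁻¹ • (ga K κ χ p - algebraMap K 𝔸 χ)) * gy K κ χ p := by
  have := RingQuot.mkAlgHom_rel K (GWARel.minus_a (K := K) (κ := κ) (χ := χ) (p := p))
  change mk K κ χ p _ = mk K κ χ p _ at this
  rwa [map_mul, map_mul, map_smul, map_sub, AlgHom.commutes] at this

theorem gya' (hκ : κ ≠ 0) : gy K κ χ p * (κ • ga K κ χ p + algebraMap K 𝔸 χ) =
    ga K κ χ p * gy K κ χ p := by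
  rw [mul_add, mul_smul_comm, gya, smul_mul_assoc, smul_smul, mul_inv_cancel₀ hκ, one_smul,
    sub_mul, ← Algebra.commutes χ (gy K κ χ p), sub_add_cancel]

/-- The universal property. -/
noncomputable def glift {B : Type*} [Ring B] [Algebra K B] (α X Y : B)
    (h1 : Y * X = aeval α p) (h2 : X * Y = aeval (κ • α + algebraMap K B χ) p)
    (h3 : X * α = (κ • α + algebraMap K B χ) * X)
    (h4 : Y * α = (κ⁻¹ • (α - algebraMap K B χ)) * Y) :
    GeneralizedWeylAlgebra K κ χ p →ₐ[K] B :=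
  RingQuot.liftAlgHom K ⟨FreeAlgebra.lift K ![α, X, Y], by
    intro u v h
    cases h with
    | minus_plus => simpa [← Polynomial.aeval_algHom_apply] using h1
    | plus_minus => simpa [← Polynomial.aeval_algHom_apply] using h2
    | plus_a => simpa using h3
    | minus_a => simpa using h4⟩

section
variable {B : Type*} [Ring B] [Algebra K B] (α X Y : B)
    (h1 : Y * X = aeval α p) (h2 : X * Y = aeval (κ • α + algebraMap K B χ) p)
    (h3 : X * α = (κ • α + algebraMap K B χ) * X)
    (h4 : Y * α = (κ⁻¹ • (α - algebraMap K B χ)) * Y)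

theorem glift_mk (u) : glift α X Y h1 h2 h3 h4 (mk K κ χ p u) =
    FreeAlgebra.lift K ![α, X, Y] u := by
  exact RingQuot.liftAlgHom_mkAlgHom_apply K _ _ _

@[simp] theorem glift_a : glift α X Y h1 h2 h3 h4 (ga K κ χ p) = α := by
  rw [ga, glift_mk]; simp
@[simp] theorem glift_x : glift α X Y h1 h2 h3 h4 (gx K κ χ p) = X := by
  rw [gx, glift_mk]; simp
@[simp] theorem glift_y : glift α X Y h1 h2 h3 h4 (gy K κ χ p) = Y := by
  rw [gy, glift_mk]; simp
end

theorem ginduction {P : 𝔸 → Prop} (h0 : ∀ r, P (algebraMap K _ r)) (ha : P (ga K κ χ p))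
    (hx : P (gx K κ χ p)) (hy : P (gy K κ χ p)) (hm : ∀ u v, P u → P v → P (u * v))
    (hadd : ∀ u v, P u → P v → P (u + v)) (u : 𝔸) : P u := by
  obtain ⟨w, rfl⟩ := mk_surjective u
  induction w using FreeAlgebra.induction with
  | grade0 r => rw [AlgHom.commutes]; exact h0 r
  | grade1 i => fin_cases i; exacts [ha, hx, hy]
  | mul a b ha hb => rw [map_mul]; exact hm _ _ ha hb
  | add a b ha hb => rw [map_add]; exact hadd _ _ ha hb

section Weight

variable {C : Type*} [CommRing C] [Algebra K C] {M : Type*} [AddCommGroup M] [Module K M]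
  [Module C M] [IsScalarTower K C M]

variable (K C M) in
/-- Diagonal operators. -/
def diag : (ℤ → C) →ₐ[K] Module.End K (ℤ → M) :=
  AlgHom.ofLinearMap
    { toFun := fun l =>
        { toFun := fun F n => l n • F n
          map_add' := fun F G => by ext n; simp
          map_smul' := fun r F => by ext n; simp [smul_comm (l n) r] }
      map_add' := fun l m => by ext F n; simp [add_smul]
      map_smul' := fun r l => by ext F n; simp }
    (by ext F n; simp) (fun l m => by ext F n; simp [mul_smul])

@[simp] theorem diag_apply (l : ℤ → C) (F : ℤ → M) (n : ℤ) : diag K C M l F n = l n • F n := rfl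

variable (K M) in
/-- Shift operators. -/
def shift (k : ℤ) : Module.End K (ℤ → M) := LinearMap.funLeft K M (fun n => n + k)

@[simp] theorem shift_apply (k : ℤ) (F : ℤ → M) (n : ℤ) : shift K M k F n = F (n + k) := rfl

variable (M) in
/-- The weight representation. -/
noncomputable def wrep (hκ : κ ≠ 0) (l : ℤ → C)
    (hl : ∀ n, l (n + 1) = κ • l n + algebraMap K C χ) :
    GeneralizedWeylAlgebra K κ χ p →ₐ[K] Module.End K (ℤ → M) :=
  glift (diag K C M l) (diag K C M (fun n => aeval (l (n + 1)) p) * shift K M 1) (shift K M (-1))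
    (by
      rw [Polynomial.aeval_algHom_apply]
      ext F n
      simp only [Module.End.mul_apply, shift_apply, diag_apply]
      rw [Polynomial.aeval_pi_apply₂]
      simp)
    (by
      rw [← (diag K C M).commutes χ, ← map_smul, ← map_add, Polynomial.aeval_algHom_apply]
      ext F n
      simp only [Module.End.mul_apply, shift_apply, diag_apply]
      rw [Polynomial.aeval_pi_apply₂]
      simp [hl])
    (by
      rw [← (diag K C M).commutes χ, ← map_smul, ← map_add]
      ext F n
      simp only [Module.End.mul_apply, shift_apply, diag_apply]
      simp [hl, smul_smul, mul_comm])
    (by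
      rw [← (diag K C M).commutes χ, ← map_sub, ← map_smul]
      ext F n
      simp only [Module.End.mul_apply, shift_apply, diag_apply]
      have := hl (n + -1)
      rw [neg_add_cancel_right] at this
      simp [this, smul_smul, inv_mul_cancel₀ hκ])

variable (hκ : κ ≠ 0) (l : ℤ → C) (hl : ∀ n, l (n + 1) = κ • l n + algebraMap K C χ)

theorem wrep_a (F : ℤ → M) (n : ℤ) :
    wrep (p := p) M hκ l hl (ga K κ χ p) F n = l n • F n := by
  rw [wrep, glift_a]; rfl
theorem wrep_y (F : ℤ → M) (n : ℤ) :
    wrep (p := p) M hκ l hl (gy K κ χ p) F n = F (n - 1) := by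
  rw [wrep, glift_y]; rfl
theorem wrep_x (F : ℤ → M) (n : ℤ) :
    wrep (p := p) M hκ l hl (gx K κ χ p) F n = aeval (l (n + 1)) p • F (n + 1) := by
  rw [wrep, glift_x]; rfl

theorem wrep_aeval (f : Polynomial K) (F : ℤ → M) (n : ℤ) :
    wrep (p := p) M hκ l hl (aeval (ga K κ χ p) f) F n = aeval (l n) f • F n := by
  rw [← Polynomial.aeval_algHom_apply, wrep, glift_a, Polynomial.aeval_algHom_apply, diag_apply,
    Polynomial.aeval_pi_apply₂]

theorem wrep_smul (u : 𝔸) (c : C) (F : ℤ → M) :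
    wrep (p := p) M hκ l hl u (c • F) = c • wrep (p := p) M hκ l hl u F := by
  induction u using ginduction generalizing F with
  | h0 r => rw [AlgHom.commutes]; ext n; simp [smul_comm c r]
  | ha => ext n; simp [wrep_a, smul_smul, mul_comm]
  | hx => ext n; simp [wrep_x, smul_smul, mul_comm]
  | hy => ext n; simp [wrep_y]
  | hm u v hu hv => simp [hu, hv]
  | hadd u v hu hv => simp [hu, hv]

end Weight

/-- Weights. -/
noncomputable def aff {C : Type*} [CommRing C] [Algebra K C] (hκ : κ ≠ 0) (χ : K) :
    Equiv.Perm C where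
  toFun c := κ • c + algebraMap K C χ
  invFun c := κ⁻¹ • (c - algebraMap K C χ)
  left_inv c := by simp [smul_smul, inv_mul_cancel₀ hκ]
  right_inv c := by simp [smul_smul, mul_inv_cancel₀ hκ]

theorem aff_zpow {C : Type*} [CommRing C] [Algebra K C] (hκ : κ ≠ 0) (χ : K) (c : C) (n : ℤ) :
    ((aff hκ χ) ^ (n + 1)) c = κ • ((aff hκ χ) ^ n) c + algebraMap K C χ := by
  rw [add_comm, zpow_add, zpow_one, Equiv.Perm.mul_apply]; rfl

end Concrete


section Regularity

variable {K : Type u} [Field K] {κ χ : K} {p : Polynomial K}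

local notation "𝔸" => GeneralizedWeylAlgebra K κ χ p

open Polynomial

theorem gx_aeval (f : K[X]) : gx K κ χ p * aeval (ga K κ χ p) f =
    aeval (ga K κ χ p) (aeval (C κ * X + C χ) f) * gx K κ χ p := by
  induction f using Polynomial.induction_on' with
  | add f g hf hg => simp only [map_add, mul_add, add_mul, hf, hg]
  | monomial n r =>
    rw [← C_mul_X_pow_eq_monomial]
    simp only [map_mul, map_pow, aeval_X, aeval_C, map_add]
    rw [← mul_assoc, ← Algebra.commutes, mul_assoc, mul_assoc, Polynomial.algebraMap_eq, aeval_C]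
    congr 1
    have h : SemiconjBy (gx K κ χ p) (ga K κ χ p)
        (algebraMap K 𝔸 κ * ga K κ χ p + algebraMap K 𝔸 χ) := by
      have := gxa (K := K) (κ := κ) (χ := χ) (p := p)
      rwa [Algebra.smul_def] at this
    simpa using (h.pow_right n).eq

theorem gy_aeval (hκ : κ ≠ 0) (f : K[X]) : gy K κ χ p *
    aeval (ga K κ χ p) (aeval (C κ * X + C χ) f) = aeval (ga K κ χ p) f * gy K κ χ p := by
  induction f using Polynomial.induction_on' with
  | add f g hf hg => simp only [map_add, mul_add, add_mul, hf, hg]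
  | monomial n r =>
    rw [← C_mul_X_pow_eq_monomial]
    simp only [map_mul, map_pow, aeval_X, aeval_C, map_add]
    rw [← mul_assoc, Polynomial.algebraMap_eq, aeval_C, ← Algebra.commutes, mul_assoc, mul_assoc]
    congr 1
    have h : SemiconjBy (gy K κ χ p)
        (algebraMap K 𝔸 κ * ga K κ χ p + algebraMap K 𝔸 χ) (ga K κ χ p) := by
      have := gya' (K := K) (κ := κ) (χ := χ) (p := p) hκ
      rwa [Algebra.smul_def] at this
    simpa using (h.pow_right n).eq

theorem aff_comp (hκ : κ ≠ 0) (f : K[X]) :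
    aeval (C κ * X + C χ) (aeval (C κ⁻¹ * (X - C χ)) f) = f := by
  rw [← Polynomial.aeval_algHom_apply]
  have : (aeval (C κ * X + C χ)) (C κ⁻¹ * (X - C χ)) = (X : K[X]) := by
    simp [← mul_assoc, ← C_mul, inv_mul_cancel₀ hκ]
  rw [this]; simp

theorem aff_comp' (hκ : κ ≠ 0) (f : K[X]) :
    aeval (C κ⁻¹ * (X - C χ)) (aeval (C κ * X + C χ) f) = f := by
  rw [← Polynomial.aeval_algHom_apply]
  have : (aeval (C κ⁻¹ * (X - C χ))) (C κ * X + C χ) = (X : K[X]) := by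
    simp [← mul_assoc, ← C_mul, mul_inv_cancel₀ hκ]
  rw [this]; simp

variable (K κ χ p) in
/-- The homogeneous basis elements. -/
noncomputable def bas : ℤ → GeneralizedWeylAlgebra K κ χ p
  | Int.ofNat m => gy K κ χ p ^ m
  | Int.negSucc m => gx K κ χ p ^ (m + 1)

theorem ypow_comm (hκ : κ ≠ 0) (m : ℕ) (f : K[X]) : ∃ g : K[X],
    aeval (ga K κ χ p) f * gy K κ χ p ^ m = gy K κ χ p ^ m * aeval (ga K κ χ p) g := by
  induction m generalizing f with
  | zero => exact ⟨f, by simp⟩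
  | succ m ih =>
    obtain ⟨g, hg⟩ := ih (aeval (C κ * X + C χ) f)
    exact ⟨g, by rw [pow_succ', ← mul_assoc, ← gy_aeval hκ, mul_assoc, hg, mul_assoc]⟩

theorem xpow_comm (hκ : κ ≠ 0) (m : ℕ) (f : K[X]) : ∃ g : K[X],
    aeval (ga K κ χ p) f * gx K κ χ p ^ m = gx K κ χ p ^ m * aeval (ga K κ χ p) g := by
  induction m generalizing f with
  | zero => exact ⟨f, by simp⟩
  | succ m ih =>
    obtain ⟨g, hg⟩ := ih (aeval (C κ⁻¹ * (X - C χ)) f)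
    refine ⟨g, ?_⟩
    conv_lhs => rw [← aff_comp (χ := χ) hκ f]
    rw [pow_succ', ← mul_assoc, ← gx_aeval, mul_assoc, hg, mul_assoc]

theorem bas_comm (hκ : κ ≠ 0) (n : ℤ) (f : K[X]) : ∃ g : K[X],
    aeval (ga K κ χ p) f * bas K κ χ p n = bas K κ χ p n * aeval (ga K κ χ p) g := by
  cases n with
  | ofNat m => exact ypow_comm hκ m f
  | negSucc m => exact xpow_comm hκ _ f

theorem gy_bas (n : ℤ) : ∃ (m : ℤ) (f : K[X]),
    gy K κ χ p * bas K κ χ p n = aeval (ga K κ χ p) f * bas K κ χ p m := by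
  rcases n with m | _ | m
  · exact ⟨Int.ofNat (m + 1), 1, by simp [bas, pow_succ']⟩
  · exact ⟨Int.ofNat 0, p, by simp [bas, gyx]⟩
  · exact ⟨Int.negSucc m, p, by simp only [bas]; rw [pow_succ', ← mul_assoc, gyx]⟩

theorem gxy' : gx K κ χ p * gy K κ χ p =
    aeval (ga K κ χ p) (aeval (C κ * X + C χ) p) := by
  rw [gxy, ← Polynomial.aeval_algHom_apply]; simp [Algebra.smul_def]

theorem gx_bas (n : ℤ) : ∃ (m : ℤ) (f : K[X]),
    gx K κ χ p * bas K κ χ p n = aeval (ga K κ χ p) f * bas K κ χ p m := by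
  rcases n with (_ | m) | m
  · exact ⟨Int.negSucc 0, 1, by simp [bas]⟩
  · exact ⟨Int.ofNat m, aeval (C κ * X + C χ) p, by
      simp only [bas]; rw [pow_succ', ← mul_assoc, gxy']⟩
  · exact ⟨Int.negSucc (m + 1), 1, by simp only [bas]; simp [pow_succ']⟩

variable (K κ χ p) in
/-- The spanning map. -/
noncomputable def spanMap : (ℤ →₀ K[X]) →ₗ[K] GeneralizedWeylAlgebra K κ χ p :=
  Finsupp.lsum K (fun n => LinearMap.mulLeft K (bas K κ χ p n) ∘ₗ
    (aeval (ga K κ χ p)).toLinearMap)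

theorem spanMap_apply (r : ℤ →₀ K[X]) : spanMap K κ χ p r =
    r.sum (fun n f => bas K κ χ p n * aeval (ga K κ χ p) f) := rfl

theorem bas_mem (n : ℤ) (f : K[X]) :
    bas K κ χ p n * aeval (ga K κ χ p) f ∈ LinearMap.range (spanMap K κ χ p) :=
  ⟨Finsupp.single n f, by rw [spanMap_apply, Finsupp.sum_single_index]; simp⟩

theorem spanMap_of {v : 𝔸} (hv : ∀ (n : ℤ) (f : K[X]), v * (bas K κ χ p n * aeval (ga K κ χ p) f) ∈
    LinearMap.range (spanMap K κ χ p)) (w : 𝔸) (hw : w ∈ LinearMap.range (spanMap K κ χ p)) :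
    v * w ∈ LinearMap.range (spanMap K κ χ p) := by
  obtain ⟨r, rfl⟩ := hw
  rw [spanMap_apply, Finsupp.sum, Finset.mul_sum]
  exact Submodule.sum_mem _ fun n _ => hv _ _

theorem spanMap_surjective (hκ : κ ≠ 0) : Function.Surjective (spanMap K κ χ p) := by
  have key : ∀ u w : 𝔸, w ∈ LinearMap.range (spanMap K κ χ p) →
      u * w ∈ LinearMap.range (spanMap K κ χ p) := by
    intro u
    induction u using ginduction with
    | h0 r =>
      intro w hw; rw [← Algebra.smul_def]; exact Submodule.smul_mem _ _ hw
    | ha =>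
      refine spanMap_of fun n f => ?_
      obtain ⟨g, hg⟩ := bas_comm (κ := κ) (χ := χ) (p := p) hκ n X
      rw [aeval_X] at hg
      rw [← mul_assoc, hg, mul_assoc, ← map_mul]; exact bas_mem _ _
    | hx =>
      refine spanMap_of fun n f => ?_
      obtain ⟨m, g, hg⟩ := gx_bas (κ := κ) (χ := χ) (p := p) n
      obtain ⟨g', hg'⟩ := bas_comm (κ := κ) (χ := χ) (p := p) hκ m g
      rw [← mul_assoc, hg, hg', mul_assoc, ← map_mul]; exact bas_mem _ _
    | hy =>
      refine spanMap_of fun n f => ?_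
      obtain ⟨m, g, hg⟩ := gy_bas (κ := κ) (χ := χ) (p := p) n
      obtain ⟨g', hg'⟩ := bas_comm (κ := κ) (χ := χ) (p := p) hκ m g
      rw [← mul_assoc, hg, hg', mul_assoc, ← map_mul]; exact bas_mem _ _
    | hm u v hu hv => intro w hw; rw [mul_assoc]; exact hu _ (hv _ hw)
    | hadd u v hu hv => intro w hw; rw [add_mul]; exact Submodule.add_mem _ (hu _ hw) (hv _ hw)
  intro u
  have := key u 1 (by have := bas_mem (κ := κ) (χ := χ) (p := p) 0 1; simpa [bas] using this)
  rwa [mul_one] at this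

/-- The generic weights. -/
noncomputable def gl (hκ : κ ≠ 0) (χ : K) (n : ℤ) : K[X] := ((aff hκ χ) ^ n) X

theorem gl_succ (hκ : κ ≠ 0) (n : ℤ) :
    gl hκ χ (n + 1) = κ • gl hκ χ n + algebraMap K K[X] χ := aff_zpow hκ χ X n

theorem gl_zero (hκ : κ ≠ 0) : gl hκ χ 0 = X := by simp [gl]

theorem gl_natDegree (hκ : κ ≠ 0) (n : ℤ) : (gl hκ χ n).natDegree = 1 := by
  have step : ∀ n : ℤ, (gl hκ χ (n + 1)).natDegree = (gl hκ χ n).natDegree := by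
    intro n
    rw [gl_succ, Polynomial.algebraMap_eq, natDegree_add_C, natDegree_smul _ hκ]
  induction n using Int.induction_on with
  | zero => simp [gl_zero]
  | succ n ih => rw [step, ih]
  | pred n ih => rw [← step, ← ih]; simp

theorem aeval_gl_ne (hκ : κ ≠ 0) (n : ℤ) {f : K[X]} (hf : f ≠ 0) : aeval (gl hκ χ n) f ≠ 0 := by
  intro h
  rw [← Polynomial.comp_eq_aeval, Polynomial.comp_eq_zero_iff] at h
  rcases h with h | ⟨_, h⟩
  · exact hf h
  · have := gl_natDegree (χ := χ) hκ n
    rw [h] at this; simp at this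

/-- The generic weight representation. -/
noncomputable def grep (hκ : κ ≠ 0) :
    GeneralizedWeylAlgebra K κ χ p →ₐ[K] Module.End K (ℤ → K[X]) :=
  wrep K[X] hκ (gl hκ χ) (gl_succ hκ)

theorem grep_y_single (hκ : κ ≠ 0) (m : ℤ) (c : K[X]) :
    grep hκ (gy K κ χ p) (Pi.single m c) = Pi.single (m + 1) c := by
  ext1 n
  rw [grep, wrep_y]
  by_cases h : n = m + 1
  · subst h; simp
  · rw [Pi.single_eq_of_ne h, Pi.single_eq_of_ne (by omega)]

theorem grep_x_single (hκ : κ ≠ 0) (m : ℤ) (c : K[X]) :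
    grep hκ (gx K κ χ p) (Pi.single m c) = Pi.single (m - 1) (aeval (gl hκ χ m) p * c) := by
  ext1 n
  rw [grep, wrep_x]
  by_cases h : n = m - 1
  · subst h; simp
  · rw [Pi.single_eq_of_ne h, Pi.single_eq_of_ne (by omega), smul_zero]

theorem grep_bas (hκ : κ ≠ 0) (hp : p ≠ 0) (n : ℤ) : ∃ c : K[X], c ≠ 0 ∧
    grep hκ (bas K κ χ p n) (Pi.single 0 1) = Pi.single n c := by
  rcases n with m | m
  · refine ⟨1, one_ne_zero, ?_⟩
    simp only [bas]
    induction m with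
    | zero => simp
    | succ m ih => rw [pow_succ', map_mul, Module.End.mul_apply, ih, grep_y_single]; rfl
  · simp only [bas]
    induction m with
    | zero =>
      refine ⟨_, ?_, by rw [zero_add, pow_one, grep_x_single]; rfl⟩
      rw [mul_one]; exact aeval_gl_ne hκ _ hp
    | succ m ih =>
      obtain ⟨c, hc, ih⟩ := ih
      refine ⟨_, ?_, by rw [pow_succ', map_mul, Module.End.mul_apply, ih, grep_x_single]; rfl⟩
      exact mul_ne_zero (aeval_gl_ne hκ _ hp) hc

theorem grep_mul_aeval (hκ : κ ≠ 0) (u : 𝔸) (f : K[X]) :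
    grep hκ (u * aeval (ga K κ χ p) f) (Pi.single 0 1) =
      f • grep hκ u (Pi.single 0 1) := by
  rw [map_mul, Module.End.mul_apply, grep, ← wrep_smul]
  congr 1
  ext1 n
  rw [wrep_aeval]
  by_cases h : n = 0
  · subst h; simp [gl_zero]
  · simp [Pi.single_eq_of_ne h]

theorem grep_injective (hκ : κ ≠ 0) (hp : p ≠ 0) (u : 𝔸)
    (hu : grep hκ u (Pi.single 0 1) = 0) : u = 0 := by
  obtain ⟨r, rfl⟩ := spanMap_surjective hκ u
  suffices r = 0 by rw [this, map_zero]
  choose c hc hcb using grep_bas (κ := κ) (χ := χ) (p := p) hκ hp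
  ext1 n
  have h := congrFun hu n
  rw [spanMap_apply, Finsupp.sum, map_sum, LinearMap.sum_apply, Finset.sum_apply] at h
  simp only [grep_mul_aeval, hcb, Pi.smul_apply] at h
  rw [Finset.sum_eq_single n] at h
  · simpa [hc] using h
  · intro m _ hm; rw [Pi.single_eq_of_ne hm.symm, smul_zero]
  · intro hn; rw [Finsupp.notMem_support_iff.mp hn, zero_smul]

/-- Coordinates. -/
noncomputable def coo (hκ : κ ≠ 0) (n : ℤ) (k : ℕ) : GeneralizedWeylAlgebra K κ χ p →ₗ[K] K :=
  lcoeff K k ∘ₗ LinearMap.proj n ∘ₗ LinearMap.applyₗ (Pi.single 0 1 : ℤ → K[X]) ∘ₗ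
    (grep hκ).toLinearMap

theorem coo_apply (hκ : κ ≠ 0) (n : ℤ) (k : ℕ) (u : 𝔸) :
    coo hκ n k u = (grep hκ u (Pi.single 0 1) n).coeff k := rfl

theorem coo_succ (hκ : κ ≠ 0) (n : ℤ) (k : ℕ) (u : 𝔸) :
    coo hκ n (k + 1) (u * ga K κ χ p) = coo hκ n k u := by
  have := grep_mul_aeval hκ u X
  rw [aeval_X] at this
  rw [coo_apply, this, coo_apply, Pi.smul_apply, smul_eq_mul, coeff_X_mul]

variable {W : Type*} [AddCommGroup W] [Module K W]

/-- Coordinates on a tensor product. -/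
noncomputable def Gc (W : Type*) [AddCommGroup W] [Module K W] (hκ : κ ≠ 0) (n : ℤ) (k : ℕ) :
    GeneralizedWeylAlgebra K κ χ p ⊗[K] W →ₗ[K] W :=
  (TensorProduct.lid K W).toLinearMap ∘ₗ (coo hκ n k).rTensor W

theorem Gc_tmul (hκ : κ ≠ 0) (n : ℤ) (k : ℕ) (u : 𝔸) (w : W) :
    Gc W hκ n k (u ⊗ₜ w) = coo hκ n k u • w := by simp [Gc]

theorem Gc_eventually (hκ : κ ≠ 0) (n : ℤ) (z : 𝔸 ⊗[K] W) : ∃ N, ∀ k, N ≤ k →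
    Gc W hκ n k z = 0 := by
  induction z using TensorProduct.induction_on with
  | zero => exact ⟨0, by simp⟩
  | tmul u w =>
    refine ⟨(grep hκ u (Pi.single 0 1) n).natDegree + 1, fun k hk => ?_⟩
    rw [Gc_tmul, coo_apply, coeff_eq_zero_of_natDegree_lt (by omega), zero_smul]
  | add z z' h h' =>
    obtain ⟨N, h⟩ := h
    obtain ⟨N', h'⟩ := h'
    exact ⟨max N N', fun k hk => by
      rw [map_add, h k (le_trans (le_max_left _ _) hk), h' k (le_trans (le_max_right _ _) hk),
        add_zero]⟩

theorem Gc_joint (hκ : κ ≠ 0) (hp : p ≠ 0) (z : 𝔸 ⊗[K] W) (hz : ∀ n k, Gc W hκ n k z = 0) :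
    z = 0 := by
  classical
  let B := Module.Free.chooseBasis K W
  apply (TensorProduct.equivFinsuppOfBasisRight (M := 𝔸) B).injective
  rw [map_zero]
  ext1 i
  rw [Finsupp.zero_apply]
  apply grep_injective hκ hp
  ext n k
  have : ∀ z : 𝔸 ⊗[K] W, coo hκ n k (TensorProduct.equivFinsuppOfBasisRight B z i) =
      B.coord i (Gc W hκ n k z) := by
    intro z
    induction z using TensorProduct.induction_on with
    | zero => simp
    | tmul u w => simp [Gc_tmul, mul_comm]
    | add z z' h h' => simp [h, h']
  simpa [hz, coo_apply] using this z

theorem regular (hκ : κ ≠ 0) (hp : p ≠ 0) (τ : W →ₗ[K] W) (z : 𝔸 ⊗[K] W)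
    (hz : (LinearMap.mulRight K (ga K κ χ p)).rTensor W z = τ.lTensor 𝔸 z) : z = 0 := by
  have h1 : ∀ n k (z : 𝔸 ⊗[K] W), Gc W hκ n (k + 1)
      ((LinearMap.mulRight K (ga K κ χ p)).rTensor W z) = Gc W hκ n k z := by
    intro n k z
    induction z using TensorProduct.induction_on with
    | zero => simp
    | tmul u w => simp [Gc_tmul, coo_succ]
    | add z z' h h' => simp [h, h']
  have h2 : ∀ n k (z : 𝔸 ⊗[K] W), Gc W hκ n k (τ.lTensor 𝔸 z) = τ (Gc W hκ n k z) := by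
    intro n k z
    induction z using TensorProduct.induction_on with
    | zero => simp
    | tmul u w => simp [Gc_tmul]
    | add z z' h h' => simp [h, h']
  apply Gc_joint hκ hp
  intro n k
  obtain ⟨N, hN⟩ := Gc_eventually hκ n z
  have key : ∀ m k, N ≤ k + m → Gc W hκ n k z = 0 := by
    intro m
    induction m with
    | zero => intro k hk; exact hN k hk
    | succ m ih =>
      intro k hk
      rw [← h1, hz, h2, ih (k + 1) (by omega), map_zero]
  exact key N k (by omega)

end Regularity


section ConcreteCfg

variable {K : Type u} [Field K] {κ χ : K} {p : Polynomial K}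

local notation "𝔸" => GeneralizedWeylAlgebra K κ χ p

open Polynomial MulOpposite

theorem poly_ind {P : K[X] → Prop} (hC : ∀ r, P (C r)) (hadd : ∀ f g, P f → P g → P (f + g))
    (hX : ∀ f, P f → P (X * f)) (f : K[X]) : P f := by
  induction f using Polynomial.induction_on with
  | C a => exact hC a
  | add f g hf hg => exact hadd f g hf hg
  | monomial n a h =>
    have := hX _ h
    rwa [show X * (C a * X ^ n) = C a * X ^ (n + 1) by ring] at this

variable (K) in
/-- The difference quotient map. -/
noncomputable def Qm : K[X] →ₗ[K] K[X] ⊗[K] K[X] :=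
  (Polynomial.basisMonomials K).constr K
    (fun n => ∑ i ∈ Finset.range n, (X ^ i : K[X]) ⊗ₜ[K] (X ^ (n - 1 - i) : K[X]))

theorem Qm_mon (n : ℕ) : Qm K (X ^ n) =
    ∑ i ∈ Finset.range n, (X ^ i : K[X]) ⊗ₜ[K] (X ^ (n - 1 - i) : K[X]) := by
  have := (Polynomial.basisMonomials K).constr_basis K
    (fun n => ∑ i ∈ Finset.range n, (X ^ i : K[X]) ⊗ₜ[K] (X ^ (n - 1 - i) : K[X])) n
  simp only [coe_basisMonomials] at this
  rwa [← X_pow_eq_monomial] at this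

theorem Qm_C (r : K) : Qm K (C r) = 0 := by
  have : C r = r • (X ^ 0 : K[X]) := by simp [smul_eq_C_mul]
  rw [this, map_smul, Qm_mon]; simp

theorem Qm_X_mul (f : K[X]) : Qm K (X * f) =
    (X ⊗ₜ[K] (1 : K[X])) * Qm K f + (1 : K[X]) ⊗ₜ[K] f := by
  induction f using Polynomial.induction_on' with
  | add f g hf hg => rw [mul_add, map_add, map_add, hf, hg, tmul_add]; ring
  | monomial n r =>
    have h : monomial n r = r • (X ^ n : K[X]) := by rw [smul_X_eq_monomial]
    rw [h, mul_smul_comm, map_smul, map_smul, tmul_smul, mul_smul_comm, ← smul_add]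
    congr 1
    rw [← pow_succ', Qm_mon, Qm_mon, Finset.sum_range_succ', Finset.mul_sum]
    congr 1
    · refine Finset.sum_congr rfl fun i hi => ?_
      rw [Algebra.TensorProduct.tmul_mul_tmul, one_mul, pow_succ']
      congr 2
      omega

variable (K) in
noncomputable def dd : K[X] ⊗[K] K[X] := X ⊗ₜ 1 - 1 ⊗ₜ X

theorem Qm_sub (f : K[X]) : f ⊗ₜ[K] (1 : K[X]) - (1 : K[X]) ⊗ₜ[K] f = dd K * Qm K f := by
  induction f using poly_ind with
  | hC r =>
    rw [Qm_C, mul_zero, ← mul_one (C r), ← smul_eq_C_mul, smul_tmul, sub_self]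
  | hadd f g hf hg =>
    rw [map_add, mul_add, ← hf, ← hg, add_tmul, tmul_add]; abel
  | hX f hf =>
    rw [Qm_X_mul]
    have e1 : (X * f) ⊗ₜ[K] (1 : K[X]) = (X ⊗ₜ 1) * (f ⊗ₜ 1) := by simp
    have e2 : (1 : K[X]) ⊗ₜ[K] (X * f) = (1 ⊗ₜ X) * (1 ⊗ₜ f) := by simp
    rw [e1, e2]
    have e3 : dd K = X ⊗ₜ 1 - 1 ⊗ₜ X := rfl
    linear_combination (X ⊗ₜ[K] (1 : K[X])) * hf - (1 ⊗ₜ[K] f) * e3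

theorem Qm_deriv (f : K[X]) : ∃ k, Qm K f = (derivative f) ⊗ₜ[K] (1 : K[X]) - dd K * k := by
  induction f using poly_ind with
  | hC r => exact ⟨0, by simp [Qm_C]⟩
  | hadd f g hf hg =>
    obtain ⟨k, hk⟩ := hf
    obtain ⟨l, hl⟩ := hg
    exact ⟨k + l, by rw [map_add, hk, hl, derivative_add, add_tmul]; ring⟩
  | hX f hf =>
    obtain ⟨k, hk⟩ := hf
    refine ⟨(X ⊗ₜ 1) * k + Qm K f, ?_⟩
    rw [Qm_X_mul, derivative_mul, derivative_X, one_mul, add_tmul]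
    have e1 : (X * derivative f) ⊗ₜ[K] (1 : K[X]) = (X ⊗ₜ 1) * (derivative f ⊗ₜ 1) := by simp
    rw [e1]
    linear_combination (X ⊗ₜ[K] (1 : K[X])) * hk - Qm_sub f

theorem aeval_op' {B : Type*} [Ring B] [Algebra K B] (b : B) (f : K[X]) :
    aeval (op b) f = op (aeval b f) := by
  induction f using poly_ind with
  | hC r => simp
  | hadd f g hf hg => simp [hf, hg]
  | hX f hf =>
    rw [map_mul, map_mul, hf, aeval_X, ← op_mul]
    rw [aeval_X]
    congr 1
    have := congrArg (aeval b) (mul_comm f X)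
    rwa [map_mul, map_mul, aeval_X] at this

variable (K κ χ) in
/-- The automorphism. -/
noncomputable def ππ : K[X] →ₐ[K] K[X] := aeval (C κ * X + C χ)

variable (K κ χ p) in
/-- The concrete configuration. -/
noncomputable def cfg (hκ : κ ≠ 0) :
    Cfg (GeneralizedWeylAlgebra K κ χ p ⊗[K] (GeneralizedWeylAlgebra K κ χ p)ᵐᵒᵖ)
      (K[X] ⊗[K] K[X]) where
  ev := (Algebra.TensorProduct.map (aeval (ga K κ χ p)) (aeval (op (ga K κ χ p)))).toRingHom
  π₁ := (Algebra.TensorProduct.map (ππ K κ χ) (AlgHom.id K K[X])).toRingHom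
  π₂ := (Algebra.TensorProduct.map (AlgHom.id K K[X]) (ππ K κ χ)).toRingHom
  comm h := by
    induction h using TensorProduct.induction_on with
    | zero => simp
    | tmul f g => simp
    | add f g hf hg => rw [map_add, map_add, hf, hg, map_add, map_add]
  x := gx K κ χ p ⊗ₜ 1
  y := gy K κ χ p ⊗ₜ 1
  x' := 1 ⊗ₜ op (gx K κ χ p)
  y' := 1 ⊗ₜ op (gy K κ χ p)
  k := algebraMap K _ κ
  hx h := by
    induction h using TensorProduct.induction_on with
    | zero => simp
    | tmul f g => simp [gx_aeval, ππ]
    | add f g hf hg => rw [map_add, mul_add, hf, hg, map_add, map_add, add_mul]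
  hy h := by
    induction h using TensorProduct.induction_on with
    | zero => simp
    | tmul f g => simp [gy_aeval hκ, ππ]
    | add f g hf hg => rw [map_add, map_add, mul_add, hf, hg, map_add, add_mul]
  hx' h := by
    induction h using TensorProduct.induction_on with
    | zero => simp
    | tmul f g => simp [gx_aeval, ππ, aeval_op', ← op_mul]
    | add f g hf hg => rw [map_add, map_add, mul_add, hf, hg, map_add, add_mul]
  hy' h := by
    induction h using TensorProduct.induction_on with
    | zero => simp
    | tmul f g => simp [gy_aeval hκ, ππ, aeval_op', ← op_mul]
    | add f g hf hg => rw [map_add, mul_add, hf, hg, map_add, map_add, add_mul]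
  xx' := by simp
  xy' := by simp
  yx' := by simp
  yy' := by simp
  P1 := p ⊗ₜ 1
  P2 := 1 ⊗ₜ p
  d := dd K
  q := Qm K p
  hP1 := by simp
  hP2 := by simp
  hq := Qm_sub p
  hyx := by simp [gyx]
  hxy := by simp [gxy', ππ]
  hxy_opp := by simp [← op_mul, gyx, aeval_op']
  hyx_opp := by simp [← op_mul, gxy', ππ, aeval_op']
  hk := by
    simp only [dd, ππ, map_sub, Algebra.algebraMap_eq_smul_one, smul_mul_assoc, one_mul, smul_sub]
    simp [tmul_add, add_tmul, ← smul_eq_C_mul, ← smul_tmul', Algebra.algebraMap_eq_smul_one]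

end ConcreteCfg


section ExactA

variable {K : Type u} [Field K] {κ χ : K} {p : Polynomial K}

local notation "𝔸" => GeneralizedWeylAlgebra K κ χ p

open Polynomial MulOpposite

theorem cfg_d (hκ : κ ≠ 0) : (cfg K κ χ p hκ).ev (cfg K κ χ p hκ).d =
    ga K κ χ p ⊗ₜ 1 - 1 ⊗ₜ op (ga K κ χ p) := by
  simp [cfg, dd]

theorem cfg_pd (hκ : κ ≠ 0) : (cfg K κ χ p hκ).ev ((cfg K κ χ p hκ).π₁ (cfg K κ χ p hκ).d) =
    (κ • ga K κ χ p + algebraMap K _ χ) ⊗ₜ 1 - 1 ⊗ₜ op (ga K κ χ p) := by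
  simp [cfg, dd, ππ, Algebra.smul_def]

theorem cfg_pd' (hκ : κ ≠ 0) : (cfg K κ χ p hκ).ev ((cfg K κ χ p hκ).π₂ (cfg K κ χ p hκ).d) =
    ga K κ χ p ⊗ₜ 1 - 1 ⊗ₜ op (κ • ga K κ χ p + algebraMap K _ χ) := by
  simp [cfg, dd, ππ, Algebra.smul_def, Algebra.commutes κ (ga K κ χ p)]

theorem reg_of (hκ : κ ≠ 0) (hp : p ≠ 0) (b : 𝔸ᵐᵒᵖ) (v : 𝔸 ⊗[K] 𝔸ᵐᵒᵖ)
    (hv : v * (ga K κ χ p ⊗ₜ 1 - 1 ⊗ₜ b) = 0) : v = 0 := by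
  apply regular hκ hp (LinearMap.mulRight K b)
  rw [mul_sub, sub_eq_zero] at hv
  have h1 : ∀ v : 𝔸 ⊗[K] 𝔸ᵐᵒᵖ, (LinearMap.mulRight K (ga K κ χ p)).rTensor 𝔸ᵐᵒᵖ v =
      v * (ga K κ χ p ⊗ₜ 1) := by
    intro v
    induction v using TensorProduct.induction_on with
    | zero => simp
    | tmul u w => simp
    | add z z' h h' => simp [h, h', add_mul]
  have h2 : ∀ v : 𝔸 ⊗[K] 𝔸ᵐᵒᵖ, (LinearMap.mulRight K b).lTensor 𝔸 v = v * (1 ⊗ₜ b) := by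
    intro v
    induction v using TensorProduct.induction_on with
    | zero => simp
    | tmul u w => simp
    | add z z' h h' => simp [h, h', add_mul]
  rw [h1, h2, hv]

theorem cfg_ht0 (hκ : κ ≠ 0) (hp : p ≠ 0) (v : 𝔸 ⊗[K] 𝔸ᵐᵒᵖ)
    (hv : v * (cfg K κ χ p hκ).ev (cfg K κ χ p hκ).d = 0) : v = 0 := by
  rw [cfg_d] at hv; exact reg_of hκ hp _ v hv

theorem cfg_htp (hκ : κ ≠ 0) (hp : p ≠ 0) (v : 𝔸 ⊗[K] 𝔸ᵐᵒᵖ)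
    (hv : v * (cfg K κ χ p hκ).ev ((cfg K κ χ p hκ).π₁ (cfg K κ χ p hκ).d) = 0) : v = 0 := by
  rw [cfg_pd] at hv
  refine reg_of hκ hp (κ⁻¹ • (op (ga K κ χ p) - algebraMap K _ χ)) v ?_
  have : (κ • ga K κ χ p + algebraMap K _ χ) ⊗ₜ 1 - 1 ⊗ₜ op (ga K κ χ p) =
      κ • (ga K κ χ p ⊗ₜ[K] (1 : 𝔸ᵐᵒᵖ) -
        1 ⊗ₜ (κ⁻¹ • (op (ga K κ χ p) - algebraMap K _ χ))) := by
    rw [smul_sub, ← tmul_smul κ (1 : 𝔸), smul_smul, mul_inv_cancel₀ hκ, one_smul]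
    simp [tmul_sub, add_tmul, Algebra.algebraMap_eq_smul_one, smul_tmul']
    abel
  rw [this, mul_smul_comm] at hv
  exact (smul_eq_zero.1 hv).resolve_left hκ

theorem cfg_ht2 (hκ : κ ≠ 0) (hp : p ≠ 0) (v : 𝔸 ⊗[K] 𝔸ᵐᵒᵖ)
    (hv : v * (cfg K κ χ p hκ).ev ((cfg K κ χ p hκ).π₁ ((cfg K κ χ p hκ).π₂
      (cfg K κ χ p hκ).d)) = 0) : v = 0 := by
  rw [(cfg K κ χ p hκ).hk] at hv
  have : (cfg K κ χ p hκ).k = algebraMap K _ κ := rfl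
  rw [this, ← Algebra.smul_def, mul_smul_comm] at hv
  exact cfg_ht0 hκ hp v ((smul_eq_zero.1 hv).resolve_left hκ)

variable (K κ χ p) in
/-- The bimodule structure of the algebra. -/
noncomputable abbrev modA : Module (GeneralizedWeylAlgebra K κ χ p ⊗[K]
    (GeneralizedWeylAlgebra K κ χ p)ᵐᵒᵖ) (GeneralizedWeylAlgebra K κ χ p) :=
  TensorProduct.Algebra.module

attribute [local instance] modA

theorem act_tmul (u v m : 𝔸) : (u ⊗ₜ[K] op v) • m = u * m * v := by
  change TensorProduct.Algebra.moduleAux _ _ = _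
  rw [TensorProduct.Algebra.moduleAux_apply]
  simp [mul_assoc]

variable (K κ χ p) in
/-- The multiplication map. -/
noncomputable def μm : (𝔸 ⊗[K] 𝔸ᵐᵒᵖ) →ₗ[𝔸 ⊗[K] 𝔸ᵐᵒᵖ] 𝔸 :=
  LinearMap.toSpanSingleton _ _ 1

theorem μm_tmul (u v : 𝔸) : μm K κ χ p (u ⊗ₜ[K] op v) = u * v := by
  rw [μm, LinearMap.toSpanSingleton_apply, act_tmul, mul_one]

theorem μm_surjective : Function.Surjective (μm K κ χ p) := fun u =>
  ⟨u ⊗ₜ op 1, by rw [μm_tmul, mul_one]⟩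

theorem μm_d₁ (hκ : κ ≠ 0) (m) : μm K κ χ p ((cfg K κ χ p hκ).d₁ m) = 0 := by
  have h : ∀ (z : 𝔸 ⊗[K] 𝔸ᵐᵒᵖ) (u : 𝔸), μm K κ χ p (z * (u ⊗ₜ 1 - 1 ⊗ₜ op u)) = 0 := by
    intro z u
    rw [← smul_eq_mul, map_smul, map_sub, ← op_one, μm_tmul, μm_tmul, mul_one, one_mul, sub_self,
      smul_zero]
  have : (cfg K κ χ p hκ).d₁ m = m.1 * (cfg K κ χ p hκ).ev (cfg K κ χ p hκ).d
     + m.2.1 * (gx K κ χ p ⊗ₜ 1 - 1 ⊗ₜ op (gx K κ χ p))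
     + m.2.2 * (gy K κ χ p ⊗ₜ 1 - 1 ⊗ₜ op (gy K κ χ p)) := rfl
  rw [this, cfg_d, map_add, map_add, h, h, h, add_zero, add_zero]

theorem mem_range_d₁ (hκ : κ ≠ 0) (u : 𝔸) :
    u ⊗ₜ 1 - 1 ⊗ₜ op u ∈ LinearMap.range (cfg K κ χ p hκ).d₁ := by
  induction u using ginduction with
  | h0 r =>
    rw [Algebra.algebraMap_eq_smul_one, op_smul, tmul_smul, smul_tmul', op_one, sub_self]
    exact Submodule.zero_mem _
  | ha =>
    refine ⟨(1, 0, 0), ?_⟩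
    rw [← cfg_d hκ]; simp [Cfg.d₁]
  | hx => exact ⟨(0, 1, 0), by simp [Cfg.d₁, cfg]⟩
  | hy => exact ⟨(0, 0, 1), by simp [Cfg.d₁, cfg]⟩
  | hm u v hu hv =>
    have : (u * v) ⊗ₜ 1 - 1 ⊗ₜ op (u * v) = (u ⊗ₜ[K] (1 : 𝔸ᵐᵒᵖ)) • (v ⊗ₜ 1 - (1 : 𝔸) ⊗ₜ[K] op v)
      + ((1 : 𝔸) ⊗ₜ[K] op v) • (u ⊗ₜ 1 - (1 : 𝔸) ⊗ₜ[K] op u) := by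
      simp [mul_sub]
    rw [this]
    exact Submodule.add_mem _ (Submodule.smul_mem _ _ hv) (Submodule.smul_mem _ _ hu)
  | hadd u v hu hv =>
    have : (u + v) ⊗ₜ 1 - 1 ⊗ₜ op (u + v) = (u ⊗ₜ[K] (1 : 𝔸ᵐᵒᵖ) - 1 ⊗ₜ op u)
      + (v ⊗ₜ 1 - (1 : 𝔸) ⊗ₜ[K] op v) := by
      rw [op_add, tmul_add, add_tmul]; abel
    rw [this]
    exact Submodule.add_mem _ hu hv

theorem exact_d₁_μm (hκ : κ ≠ 0) : Function.Exact (cfg K κ χ p hκ).d₁ (μm K κ χ p) := by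
  intro z
  constructor
  · intro hz
    have key : ∀ z : 𝔸 ⊗[K] 𝔸ᵐᵒᵖ, z - 1 ⊗ₜ op (μm K κ χ p z) ∈
        LinearMap.range (cfg K κ χ p hκ).d₁ := by
      intro z
      induction z using TensorProduct.induction_on with
      | zero => simp
      | tmul u w =>
        induction w using MulOpposite.rec' with
        | _ w =>
        rw [μm_tmul]
        have : u ⊗ₜ op w - 1 ⊗ₜ op (u * w) = ((1 : 𝔸) ⊗ₜ[K] op w) • (u ⊗ₜ 1 - (1 : 𝔸) ⊗ₜ[K] op u) := by
          simp [mul_sub]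
        rw [this]
        exact Submodule.smul_mem _ _ (mem_range_d₁ hκ u)
      | add z z' h h' =>
        rw [map_add, op_add, tmul_add, add_sub_add_comm]
        exact Submodule.add_mem _ h h'
    have := key z
    rw [hz, op_zero, tmul_zero, sub_zero] at this
    exact this
  · rintro ⟨m, rfl⟩
    exact μm_d₁ hκ m

end ExactA


section ExactB

set_option linter.unusedSimpArgs false

variable {K : Type u} [Field K] {κ χ : K} {p : Polynomial K}

local notation "𝔸" => GeneralizedWeylAlgebra K κ χ p

open Polynomial MulOpposite

theorem zero_smul' {S M : Type*} [Ring S] [AddCommGroup M] [Module S M] (m : M) :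
    (0 : S) • m = 0 := zero_smul _ _

theorem Qm_ππ (f : K[X]) : Qm K (ππ K κ χ f) =
    κ • Algebra.TensorProduct.map (ππ K κ χ) (ππ K κ χ) (Qm K f) := by
  induction f using poly_ind with
  | hC r =>
    have : ππ K κ χ (C r) = C r := (ππ K κ χ).commutes r
    rw [this, Qm_C, map_zero, smul_zero]
  | hadd f g hf hg => simp only [map_add, hf, hg, smul_add]
  | hX f hf =>
    have e : ππ K κ χ (X * f) = κ • (X * ππ K κ χ f) + χ • ππ K κ χ f := by
      rw [map_mul]
      simp [ππ, smul_eq_C_mul]; ring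
    rw [e, map_add, map_smul, map_smul, Qm_X_mul, Qm_X_mul, hf]
    simp only [map_add, map_mul, Algebra.TensorProduct.map_tmul, map_one]
    have e2 : ππ K κ χ X = κ • X + χ • (1 : K[X]) := by simp [ππ, smul_eq_C_mul]
    rw [e2, add_tmul, ← smul_tmul', ← smul_tmul', ← Algebra.TensorProduct.one_def, add_mul,
      smul_mul_assoc, smul_mul_assoc, one_mul]
    simp only [smul_add, smul_smul, mul_smul_comm]
    rw [mul_comm χ κ]
    abel

variable {M : Type*} [AddCommGroup M] [Module (GeneralizedWeylAlgebra K κ χ p ⊗[K]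
    (GeneralizedWeylAlgebra K κ χ p)ᵐᵒᵖ) M] [Module K M]
  [IsScalarTower K (GeneralizedWeylAlgebra K κ χ p ⊗[K]
    (GeneralizedWeylAlgebra K κ χ p)ᵐᵒᵖ) M]

/-- Left multiplication twisted by a derivation value. -/
noncomputable def Gop (v : 𝔸) (μ : M) : Module.End K (𝔸 × M) where
  toFun z := (v * z.1, (v ⊗ₜ[K] (1 : 𝔸ᵐᵒᵖ)) • z.2 + ((1 : 𝔸) ⊗ₜ[K] op z.1) • μ)
  map_add' z z' := by
    ext
    · simp [mul_add]
    · simp [tmul_add, add_smul]; abel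
  map_smul' r z := by
    ext
    · simp
    · simp [smul_comm r]

theorem Gop_apply (v : 𝔸) (μ : M) (w : 𝔸) (m : M) : Gop v μ (w, m) =
    (v * w, (v ⊗ₜ[K] (1 : 𝔸ᵐᵒᵖ)) • m + ((1 : 𝔸) ⊗ₜ[K] op w) • μ) := rfl

theorem Gop_aeval (hκ : κ ≠ 0) (μ : M) (f : K[X]) (w : 𝔸) (m : M) :
    aeval (Gop (ga K κ χ p) μ) f (w, m) = (aeval (ga K κ χ p) f * w,
      (aeval (ga K κ χ p) f ⊗ₜ[K] (1 : 𝔸ᵐᵒᵖ)) • m +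
      (((1 : 𝔸) ⊗ₜ[K] op w) * (cfg K κ χ p hκ).ev (Qm K f)) • μ) := by
  induction f using poly_ind with
  | hC r =>
    have hz : ((1 : 𝔸) ⊗ₜ[K] op w * (cfg K κ χ p hκ).ev 0) • μ = 0 := by
      rw [map_zero, mul_zero]; exact zero_smul' μ
    rw [aeval_C, aeval_C, Qm_C, hz, add_zero, Module.algebraMap_end_apply,
      Algebra.algebraMap_eq_smul_one, ← smul_tmul', smul_assoc, ← Algebra.TensorProduct.one_def,
      one_smul, smul_mul_assoc, one_mul]
    rfl
  | hadd f g hf hg =>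
    rw [map_add, LinearMap.add_apply, hf, hg, map_add, map_add, map_add, add_mul, add_tmul, mul_add,
      add_smul, add_smul]
    ext
    · simp
    · simp; abel
  | hX f hf =>
    rw [map_mul, Module.End.mul_apply, hf, aeval_X, Gop_apply, map_mul, aeval_X, Qm_X_mul, map_add,
      map_mul]
    have e1 : (cfg K κ χ p hκ).ev (X ⊗ₜ 1) = ga K κ χ p ⊗ₜ 1 := by simp [cfg]
    have e2 : (cfg K κ χ p hκ).ev (1 ⊗ₜ f) = 1 ⊗ₜ op (aeval (ga K κ χ p) f) := by
      simp [cfg, aeval_op']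
    rw [e1, e2]
    ext
    · simp [mul_assoc]
    · simp only [smul_add, smul_smul, mul_add, add_smul, ← mul_assoc,
        Algebra.TensorProduct.tmul_mul_tmul, mul_one, one_mul, op_mul, add_assoc]

theorem exists_deriv (hκ : κ ≠ 0) (α bx bye : M)
    (r1 : (gx K κ χ p ⊗ₜ[K] (1 : 𝔸ᵐᵒᵖ) - κ • (1 : 𝔸) ⊗ₜ[K] op (gx K κ χ p)) • α =
      ((κ • ga K κ χ p + algebraMap K _ χ) ⊗ₜ[K] (1 : 𝔸ᵐᵒᵖ) -
        (1 : 𝔸) ⊗ₜ[K] op (ga K κ χ p)) • bx)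
    (r2 : (κ • gy K κ χ p ⊗ₜ[K] (1 : 𝔸ᵐᵒᵖ) - (1 : 𝔸) ⊗ₜ[K] op (gy K κ χ p)) • α =
      (ga K κ χ p ⊗ₜ[K] (1 : 𝔸ᵐᵒᵖ) -
        (1 : 𝔸) ⊗ₜ[K] op (κ • ga K κ χ p + algebraMap K _ χ)) • bye)
    (r3 : (cfg K κ χ p hκ).ev (Qm K p) • α = (gy K κ χ p ⊗ₜ[K] (1 : 𝔸ᵐᵒᵖ)) • bx +
      ((1 : 𝔸) ⊗ₜ[K] op (gx K κ χ p)) • bye)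
    (r4 : (cfg K κ χ p hκ).ev (Qm K (ππ K κ χ p)) • α =
      ((1 : 𝔸) ⊗ₜ[K] op (gy K κ χ p)) • bx + (gx K κ χ p ⊗ₜ[K] (1 : 𝔸ᵐᵒᵖ)) • bye) :
    ∃ δ : 𝔸 →ₗ[K] M, δ (ga K κ χ p) = α ∧ δ (gx K κ χ p) = bx ∧ δ (gy K κ χ p) = bye ∧
      ∀ u v, δ (u * v) = (u ⊗ₜ[K] (1 : 𝔸ᵐᵒᵖ)) • δ v + ((1 : 𝔸) ⊗ₜ[K] op v) • δ u := by
  have ha' : aeval (κ • Gop (ga K κ χ p) α + algebraMap K _ χ) p =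
      aeval (Gop (ga K κ χ p) α) (ππ K κ χ p) := by
    rw [ππ, ← Polynomial.aeval_algHom_apply]; simp [Algebra.smul_def]
  have h1 : Gop (gy K κ χ p) bye * Gop (gx K κ χ p) bx = aeval (Gop (ga K κ χ p) α) p := by
    refine LinearMap.ext fun ⟨w, m⟩ => ?_
    rw [Gop_aeval hκ, mul_smul, r3, Module.End.mul_apply, Gop_apply, Gop_apply]
    ext
    · simp [← gyx, mul_assoc]
    · simp [← gyx, smul_smul, add_assoc]
  have h2 : Gop (gx K κ χ p) bx * Gop (gy K κ χ p) bye =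
      aeval (κ • Gop (ga K κ χ p) α + algebraMap K _ χ) p := by
    refine LinearMap.ext fun ⟨w, m⟩ => ?_
    rw [ha', Gop_aeval hκ, mul_smul, r4, Module.End.mul_apply, Gop_apply, Gop_apply, ππ, ← gxy']
    ext
    · simp [mul_assoc]
    · simp [smul_smul]; abel
  have h3 : Gop (gx K κ χ p) bx * Gop (ga K κ χ p) α =
      (κ • Gop (ga K κ χ p) α + algebraMap K _ χ) * Gop (gx K κ χ p) bx := by
    refine LinearMap.ext fun ⟨w, m⟩ => ?_
    have r1' := congrArg (fun z => ((1 : 𝔸) ⊗ₜ[K] op w) • z) r1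
    simp only [Module.End.mul_apply, LinearMap.add_apply, LinearMap.smul_apply,
      Module.algebraMap_end_apply, Gop_apply]
    ext
    · simp only [Prod.fst_add, Prod.smul_fst, ← mul_assoc, gxa]
      simp [add_mul, Algebra.smul_def, mul_assoc]
    · simp only [Prod.snd_add, Prod.smul_snd]
      have gxa' := gxa (K := K) (κ := κ) (χ := χ) (p := p)
      simp only [Algebra.algebraMap_eq_smul_one] at r1' gxa'
      simp only [smul_add, sub_smul, smul_sub, smul_smul, Algebra.TensorProduct.tmul_mul_tmul,
        add_tmul, op_mul, one_mul, mul_one, gxa', add_smul, ← smul_tmul', smul_assoc,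
        smul_mul_assoc, add_mul, mul_smul_comm, mul_sub, mul_add] at r1' ⊢
      rw [← sub_eq_zero] at r1' ⊢
      rw [← r1']
      simp only [smul_comm _ κ, smul_comm _ χ, smul_smul, Algebra.TensorProduct.tmul_mul_tmul,
        mul_one, one_mul]
      abel
  have h4' : Gop (gy K κ χ p) bye * (κ • Gop (ga K κ χ p) α + algebraMap K _ χ) =
      Gop (ga K κ χ p) α * Gop (gy K κ χ p) bye := by
    refine LinearMap.ext fun ⟨w, m⟩ => ?_
    have r2' := congrArg (fun z => ((1 : 𝔸) ⊗ₜ[K] op w) • z) r2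
    simp only [Module.End.mul_apply, LinearMap.add_apply, LinearMap.smul_apply,
      Module.algebraMap_end_apply, Gop_apply, Prod.smul_mk, Prod.mk_add_mk]
    have gya'' := gya' (K := K) (κ := κ) (χ := χ) (p := p) hκ
    simp only [Algebra.algebraMap_eq_smul_one] at r2' gya''
    ext
    · simp only [← mul_assoc, ← gya'']
      simp [mul_add, add_mul, mul_assoc]
    · simp only [smul_add, sub_smul, smul_sub, smul_smul, Algebra.TensorProduct.tmul_mul_tmul,
        add_tmul, tmul_add, op_add, op_smul, op_one, tmul_smul, op_mul, one_mul, mul_one,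
        ← gya'', add_smul, ← smul_tmul', smul_assoc,
        smul_mul_assoc, add_mul, mul_smul_comm, mul_sub, mul_add] at r2' ⊢
      rw [← sub_eq_zero] at r2' ⊢
      rw [← r2']
      simp only [smul_comm _ κ, smul_comm _ χ, smul_smul, Algebra.TensorProduct.tmul_mul_tmul,
        mul_one, one_mul]
      abel
  have h4 : Gop (gy K κ χ p) bye * Gop (ga K κ χ p) α =
      (κ⁻¹ • (Gop (ga K κ χ p) α - algebraMap K _ χ)) * Gop (gy K κ χ p) bye := by
    have e := congrArg (fun z => κ⁻¹ • (z - algebraMap K _ χ * Gop (gy K κ χ p) bye)) h4'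
    simp only [← sub_mul] at e
    rw [smul_mul_assoc, ← e, Algebra.commutes, ← mul_sub, add_sub_cancel_right, mul_smul_comm,
      smul_smul, inv_mul_cancel₀ hκ, one_smul]
  let Ψ : 𝔸 →ₐ[K] Module.End K (𝔸 × M) := glift _ _ _ h1 h2 h3 h4
  have key : ∀ u, ∃ e, ∀ w m, Ψ u (w, m) = (u * w, (u ⊗ₜ[K] (1 : 𝔸ᵐᵒᵖ)) • m +
      ((1 : 𝔸) ⊗ₜ[K] op w) • e) := by
    intro u
    induction u using ginduction with
    | h0 r =>
      refine ⟨0, fun w m => ?_⟩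
      rw [AlgHom.commutes, Module.algebraMap_end_apply,
        Algebra.algebraMap_eq_smul_one, ← smul_tmul', smul_assoc, ← Algebra.TensorProduct.one_def,
        one_smul, smul_mul_assoc, one_mul, smul_zero, add_zero]
      rfl
    | ha => exact ⟨α, fun w m => by rw [glift_a]; rfl⟩
    | hx => exact ⟨bx, fun w m => by rw [glift_x]; rfl⟩
    | hy => exact ⟨bye, fun w m => by rw [glift_y]; rfl⟩
    | hm u v hu hv =>
      obtain ⟨e, he⟩ := hu
      obtain ⟨f, hf⟩ := hv
      refine ⟨(u ⊗ₜ[K] (1 : 𝔸ᵐᵒᵖ)) • f + ((1 : 𝔸) ⊗ₜ[K] op v) • e, fun w m => ?_⟩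
      rw [map_mul, Module.End.mul_apply, hf, he]
      ext
      · simp [mul_assoc]
      · simp [smul_smul, add_assoc]
    | hadd u v hu hv =>
      obtain ⟨e, he⟩ := hu
      obtain ⟨f, hf⟩ := hv
      refine ⟨e + f, fun w m => ?_⟩
      rw [map_add, LinearMap.add_apply, hf, he]
      ext
      · simp [add_mul]
      · simp [add_tmul, add_smul]; abel
  let δ : 𝔸 →ₗ[K] M := LinearMap.snd K 𝔸 M ∘ₗ LinearMap.applyₗ ((1 : 𝔸), (0 : M)) ∘ₗ Ψ.toLinearMap
  have hδ : ∀ u, δ u = (Ψ u (1, 0)).2 := fun u => rfl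
  have key' : ∀ u w m, Ψ u (w, m) = (u * w, (u ⊗ₜ[K] (1 : 𝔸ᵐᵒᵖ)) • m +
      ((1 : 𝔸) ⊗ₜ[K] op w) • δ u) := by
    intro u w m
    obtain ⟨e, he⟩ := key u
    have : δ u = e := by
      rw [hδ, he]; simp [← Algebra.TensorProduct.one_def]
    rw [this, he]
  refine ⟨δ, ?_, ?_, ?_, ?_⟩
  · rw [hδ, glift_a, Gop_apply]; simp [← Algebra.TensorProduct.one_def]
  · rw [hδ, glift_x, Gop_apply]; simp [← Algebra.TensorProduct.one_def]
  · rw [hδ, glift_y, Gop_apply]; simp [← Algebra.TensorProduct.one_def]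
  · intro u v
    rw [hδ, map_mul, Module.End.mul_apply, key', key']
    simp [← Algebra.TensorProduct.one_def]

theorem exists_psi (δ : 𝔸 →ₗ[K] M)
    (hδ : ∀ u v, δ (u * v) = (u ⊗ₜ[K] (1 : 𝔸ᵐᵒᵖ)) • δ v + ((1 : 𝔸) ⊗ₜ[K] op v) • δ u) :
    ∃ ψ : 𝔸 ⊗[K] 𝔸ᵐᵒᵖ →ₗ[K] M, ∀ z u, ψ (z * (u ⊗ₜ 1 - 1 ⊗ₜ op u)) = z • δ u := by
  let B : 𝔸 →ₗ[K] 𝔸ᵐᵒᵖ →ₗ[K] M := LinearMap.mk₂ K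
    (fun u w => - ((u ⊗ₜ[K] (1 : 𝔸ᵐᵒᵖ)) • δ (unop w)))
    (fun u u' w => by rw [add_tmul, add_smul, neg_add])
    (fun r u w => by rw [← smul_tmul', smul_assoc, smul_neg])
    (fun u w w' => by rw [unop_add, map_add, smul_add, neg_add])
    (fun r u w => by rw [unop_smul, map_smul, smul_comm, smul_neg])
  refine ⟨TensorProduct.lift B, fun z u => ?_⟩
  have hB : ∀ u w, TensorProduct.lift B (u ⊗ₜ op w) = - ((u ⊗ₜ[K] (1 : 𝔸ᵐᵒᵖ)) • δ w) := by
    intro u w; rw [TensorProduct.lift.tmul]; rfl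
  induction z using TensorProduct.induction_on with
  | zero => rw [zero_mul, map_zero]; exact (zero_smul' _).symm
  | tmul v w =>
    induction w using MulOpposite.rec' with
    | _ w =>
    rw [mul_sub, Algebra.TensorProduct.tmul_mul_tmul, Algebra.TensorProduct.tmul_mul_tmul, mul_one,
      mul_one, ← op_mul, map_sub, hB, hB, hδ]
    simp [smul_smul]
  | add z z' h h' => rw [add_mul, map_add, h, h', add_smul]

theorem Cfg.D_apply {S T : Type*} [Ring S] [CommRing T] (c : Cfg S T) (v : S × S × S × S) :
    c.D v = (- (v.1 * (c.x - c.x' * c.k)) - v.2.1 * (c.y * c.k - c.y') - v.2.2.1 * c.ev c.q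
      - v.2.2.2 * (c.ev (c.π₁ (c.π₂ c.q)) * c.k),
    v.1 * c.ev (c.π₁ c.d) + v.2.2.1 * c.y + v.2.2.2 * c.y',
    v.2.1 * c.ev (c.π₂ c.d) + v.2.2.1 * c.x' + v.2.2.2 * c.x) := rfl

theorem Cfg.rels {S T M : Type*} [Ring S] [CommRing T] [AddCommGroup M] [Module S M] (c : Cfg S T)
    (π : (S × S × S) →ₗ[S] M) (hπ : ∀ v, π (c.D v) = 0) :
    (∀ m, π m = m.1 • π (1, 0, 0) + m.2.1 • π (0, 1, 0) + m.2.2 • π (0, 0, 1)) ∧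
    (c.x - c.x' * c.k) • π (1, 0, 0) = c.ev (c.π₁ c.d) • π (0, 1, 0) ∧
    (c.y * c.k - c.y') • π (1, 0, 0) = c.ev (c.π₂ c.d) • π (0, 0, 1) ∧
    c.ev c.q • π (1, 0, 0) = c.y • π (0, 1, 0) + c.x' • π (0, 0, 1) ∧
    (c.ev (c.π₁ (c.π₂ c.q)) * c.k) • π (1, 0, 0) = c.y' • π (0, 1, 0) + c.x • π (0, 0, 1) := by
  have hdec : ∀ m, π m = m.1 • π (1, 0, 0) + m.2.1 • π (0, 1, 0) + m.2.2 • π (0, 0, 1) := by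
    intro m
    rw [← map_smul, ← map_smul, ← map_smul, ← map_add, ← map_add]
    congr 1
    ext <;> simp
  have e1 := hπ (1, 0, 0, 0)
  have e2 := hπ (0, 1, 0, 0)
  have e3 := hπ (0, 0, 1, 0)
  have e4 := hπ (0, 0, 0, 1)
  rw [hdec] at e1 e2 e3 e4
  simp only [Cfg.D_apply, one_mul, zero_mul, add_zero, zero_add,
    sub_zero, neg_zero, zero_sub, zero_smul, neg_smul, add_assoc, neg_add_eq_zero] at e1 e2 e3 e4
  exact ⟨hdec, e1, e2, e3, e4⟩

theorem mul_k (hκ : κ ≠ 0) (z : 𝔸 ⊗[K] 𝔸ᵐᵒᵖ) : z * (cfg K κ χ p hκ).k = κ • z :=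
  ((Algebra.smul_def κ z).trans (Algebra.commutes κ z)).symm

theorem cfg_q2 (hκ : κ ≠ 0) : κ • (cfg K κ χ p hκ).ev ((cfg K κ χ p hκ).π₁
    ((cfg K κ χ p hκ).π₂ (cfg K κ χ p hκ).q)) = (cfg K κ χ p hκ).ev (Qm K (ππ K κ χ p)) := by
  rw [Qm_ππ]
  have : ∀ z : K[X] ⊗[K] K[X], (cfg K κ χ p hκ).π₁ ((cfg K κ χ p hκ).π₂ z) =
      Algebra.TensorProduct.map (ππ K κ χ) (ππ K κ χ) z := by
    intro z
    induction z using TensorProduct.induction_on with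
    | zero => simp
    | tmul f g => simp [cfg]
    | add f g hf hg => rw [map_add, map_add, hf, hg, map_add]
  rw [this]
  exact (map_smul (Algebra.TensorProduct.map (aeval (ga K κ χ p)) (aeval (op (ga K κ χ p)))) κ _).symm

theorem exact_aux (hκ : κ ≠ 0) (π : ((𝔸 ⊗[K] 𝔸ᵐᵒᵖ) × (𝔸 ⊗[K] 𝔸ᵐᵒᵖ) × (𝔸 ⊗[K] 𝔸ᵐᵒᵖ)) →ₗ[𝔸 ⊗[K] 𝔸ᵐᵒᵖ] M)
    (hπ : ∀ v, π ((cfg K κ χ p hκ).D v) = 0) (m) (hm : (cfg K κ χ p hκ).d₁ m = 0) : π m = 0 := by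
  obtain ⟨hdec, e1, e2, e3, e4⟩ := (cfg K κ χ p hκ).rels π hπ
  rw [mul_k, cfg_pd] at e1
  rw [mul_k, cfg_pd'] at e2
  rw [mul_k, cfg_q2] at e4
  obtain ⟨δ, ha, hx, hy, hδ⟩ := exists_deriv (κ := κ) (χ := χ) (p := p) hκ
    (π (1, 0, 0)) (π (0, 1, 0)) (π (0, 0, 1)) e1 e2 e3 e4
  obtain ⟨ψ, hψ⟩ := exists_psi δ hδ
  have h0 : ψ ((cfg K κ χ p hκ).d₁ m) = π m := by
    have : (cfg K κ χ p hκ).d₁ m = m.1 * (cfg K κ χ p hκ).ev (cfg K κ χ p hκ).d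
      + m.2.1 * (gx K κ χ p ⊗ₜ 1 - 1 ⊗ₜ op (gx K κ χ p))
      + m.2.2 * (gy K κ χ p ⊗ₜ 1 - 1 ⊗ₜ op (gy K κ χ p)) := rfl
    rw [this, cfg_d, map_add, map_add, hψ, hψ, hψ, ha, hx, hy, ← hdec]
  rw [hm, map_zero] at h0
  exact h0.symm

theorem exact_D_d₁ (hκ : κ ≠ 0) :
    Function.Exact (cfg K κ χ p hκ).D (cfg K κ χ p hκ).d₁ := by
  intro m
  constructor
  swap
  · rintro ⟨v, rfl⟩; exact (cfg K κ χ p hκ).d₁_D v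
  intro hm
  have := exact_aux hκ (LinearMap.range (cfg K κ χ p hκ).D).mkQ (fun v => by
    rw [Submodule.mkQ_apply, Submodule.Quotient.mk_eq_zero]; exact ⟨v, rfl⟩) m hm
  exact (Submodule.Quotient.mk_eq_zero _).1 this

end ExactB


section Resolution

universe w

/-- The terms of a length two resolution. -/
def resP {S : Type w} [Ring S] (Q0 Q1 Q2 : ModuleCat.{w} S) : ℕ → ModuleCat.{w} S
  | 0 => Q0
  | 1 => Q1
  | 2 => Q2
  | _ + 3 => ModuleCat.of S PUnit.{w+1}

/-- The differentials of a length two resolution. -/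
def resd {S : Type w} [Ring S] (Q0 Q1 Q2 : ModuleCat.{w} S) (f : Q1 →ₗ[S] Q0) (g : Q2 →ₗ[S] Q1) :
    ∀ i : ℕ, resP Q0 Q1 Q2 (i + 1) →ₗ[S] resP Q0 Q1 Q2 i
  | 0 => f
  | 1 => g
  | 2 => 0
  | _ + 3 => 0

theorem exists_res {S : Type w} [Ring S] {M : Type*} [AddCommGroup M] [Module S M]
    (Q0 Q1 Q2 : ModuleCat.{w} S) (f : Q1 →ₗ[S] Q0) (g : Q2 →ₗ[S] Q1) (ε : Q0 →ₗ[S] M)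
    (hf0 : Module.Finite S Q0) (hf1 : Module.Finite S Q1) (hf2 : Module.Finite S Q2)
    (hp0 : Module.Projective S Q0) (hp1 : Module.Projective S Q1) (hp2 : Module.Projective S Q2)
    (hε : Function.Surjective ε) (h0 : Function.Exact f ε) (h1 : Function.Exact g f)
    (hg : Function.Injective g) :
    ∃ (P : ℕ → ModuleCat.{w} S) (d : ∀ i : ℕ, P (i + 1) →ₗ[S] P i) (ε : P 0 →ₗ[S] M),
      (∀ i, Module.Finite S (P i)) ∧ (∀ i, Module.Projective S (P i)) ∧
      Function.Surjective ε ∧ Function.Exact (d 0) ε ∧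
      (∀ i, Function.Exact (d (i + 1)) (d i)) ∧ (∀ i, 2 < i → Subsingleton (P i)) := by
  have hs : ∀ i, Subsingleton (resP Q0 Q1 Q2 (i + 3)) := fun i =>
    inferInstanceAs (Subsingleton PUnit.{w+1})
  refine ⟨resP Q0 Q1 Q2, resd Q0 Q1 Q2 f g, ε, ?_, ?_, hε, h0, ?_, ?_⟩
  · rintro (_ | _ | _ | i)
    · exact hf0
    · exact hf1
    · exact hf2
    · exact inferInstanceAs (Module.Finite S PUnit.{w+1})
  · rintro (_ | _ | _ | i)
    · exact hp0
    · exact hp1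
    · exact hp2
    · exact inferInstanceAs (Module.Projective S PUnit.{w+1})
  · rintro (_ | _ | i)
    · exact h1
    · intro z
      constructor
      · intro hz
        refine ⟨0, ?_⟩
        rw [map_zero]
        exact (hg (hz.trans (map_zero g).symm)).symm
      · rintro ⟨w, rfl⟩
        exact map_zero g
    · intro z
      have := hs i
      have := hs (i + 1)
      constructor
      · intro _
        exact ⟨0, Subsingleton.elim _ _⟩
      · rintro ⟨w, rfl⟩
        cases i <;> rfl
  · rintro (_ | _ | _ | i) hi
    · omega
    · omega
    · omega
    · exact hs i

end Resolution

section Forward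

variable {K : Type u} [Field K] {κ χ : K} {p : Polynomial K}

local notation "𝔸" => GeneralizedWeylAlgebra K κ χ p

open Polynomial MulOpposite

theorem bezout (hκ : κ ≠ 0) {a b : K[X]} (h : a * p + b * derivative p = 1) : ∃ h3,
    (cfg K κ χ p hκ).q * (b ⊗ₜ 1) + (cfg K κ χ p hκ).P1 * (a ⊗ₜ 1) + (cfg K κ χ p hκ).d * h3 = 1 := by
  obtain ⟨k, hk⟩ := Qm_deriv p
  refine ⟨(b ⊗ₜ 1) * k, ?_⟩
  have e1 : (cfg K κ χ p hκ).q = Qm K p := rfl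
  have e2 : (cfg K κ χ p hκ).P1 = p ⊗ₜ 1 := rfl
  have e3 : (cfg K κ χ p hκ).d = dd K := rfl
  have e4 : (derivative p ⊗ₜ[K] (1 : K[X])) * (b ⊗ₜ 1) + (p ⊗ₜ[K] (1 : K[X])) * (a ⊗ₜ 1) = 1 := by
    rw [Algebra.TensorProduct.tmul_mul_tmul, Algebra.TensorProduct.tmul_mul_tmul, ← add_tmul,
      mul_one, Algebra.TensorProduct.one_def, ← h]
    congr 1
    ring
  rw [e1, e2, e3, hk]
  linear_combination e4

attribute [local instance] modA

theorem length_two (hκ : κ ≠ 0) (hp : p ≠ 0) {a b : K[X]} (h : a * p + b * derivative p = 1) :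
    HasFGProjBimoduleResolutionOfLength K (GeneralizedWeylAlgebra K κ χ p) 2 := by
  obtain ⟨h3, h⟩ := bezout (κ := κ) (χ := χ) hκ h
  obtain ⟨s, -, hs⟩ := (cfg K κ χ p hκ).exists_section h (cfg_ht0 hκ hp) (cfg_htp hκ hp)
    (cfg_ht2 hκ hp)
  refine exists_res (M := 𝔸) (ModuleCat.of _ (𝔸 ⊗[K] 𝔸ᵐᵒᵖ))
    (ModuleCat.of _ ((𝔸 ⊗[K] 𝔸ᵐᵒᵖ) × (𝔸 ⊗[K] 𝔸ᵐᵒᵖ) × (𝔸 ⊗[K] 𝔸ᵐᵒᵖ)))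
    (ModuleCat.of _ (LinearMap.range (cfg K κ χ p hκ).D)) (cfg K κ χ p hκ).d₁
    (LinearMap.range (cfg K κ χ p hκ).D).subtype (μm K κ χ p)
    (inferInstanceAs (Module.Finite (𝔸 ⊗[K] 𝔸ᵐᵒᵖ) (𝔸 ⊗[K] 𝔸ᵐᵒᵖ)))
    (inferInstanceAs (Module.Finite (𝔸 ⊗[K] 𝔸ᵐᵒᵖ) ((𝔸 ⊗[K] 𝔸ᵐᵒᵖ) × (𝔸 ⊗[K] 𝔸ᵐᵒᵖ) × (𝔸 ⊗[K] 𝔸ᵐᵒᵖ))))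
    ?_ 
    (inferInstanceAs (Module.Projective (𝔸 ⊗[K] 𝔸ᵐᵒᵖ) (𝔸 ⊗[K] 𝔸ᵐᵒᵖ)))
    (inferInstanceAs (Module.Projective (𝔸 ⊗[K] 𝔸ᵐᵒᵖ) ((𝔸 ⊗[K] 𝔸ᵐᵒᵖ) × (𝔸 ⊗[K] 𝔸ᵐᵒᵖ) × (𝔸 ⊗[K] 𝔸ᵐᵒᵖ))))
    ?_ μm_surjective (exact_d₁_μm hκ) ?_ Subtype.val_injective
  · exact Module.Finite.range (cfg K κ χ p hκ).D
  · exact Module.Projective.of_split s _ hs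
  · intro m
    rw [exact_D_d₁ hκ m]
    change _ ↔ m ∈ Set.range (Subtype.val)
    rw [Subtype.range_val]
    rfl

end Forward


section NoLengthOne

theorem Cfg.ideal_mem {S T : Type*} [Ring S] [CommRing T] (c : Cfg S T) {h1 h2 h3 : T}
    (g : (S × S × S) →ₗ[S] (S × S × S × S)) (hg : ∀ v, g (c.D v) = c.E h1 h2 h3 v) :
    (∃ a b, c.ev (c.π₂ h2) * (c.y * c.y') = (c.y * c.k - c.y') * a + c.ev (c.π₂ c.d) * b) ∧
    (∃ a b, c.ev (c.π₂ h1) * c.y' = (c.y * c.k - c.y') * a + c.ev (c.π₂ c.d) * b) := by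
  have h := hg (0, 1, 0, 0)
  have h' : g (c.D (0, 1, 0, 0)) = -((c.y * c.k - c.y') • g (1, 0, 0)) +
      c.ev (c.π₂ c.d) • g (0, 0, 1) := by
    rw [← map_smul, ← map_smul, ← map_neg, ← map_add]
    congr 1
    simp [Cfg.D_apply]
  rw [h'] at h
  constructor
  · refine ⟨(g (1, 0, 0)).1, -(g (0, 0, 1)).1, ?_⟩
    have := congrArg Prod.fst h
    simp [Cfg.E, Cfg.Eq, Cfg.Ep, Cfg.Ed, Cfg.θ] at this
    linear_combination (norm := noncomm_ring) this
  · refine ⟨(g (1, 0, 0)).2.2.1, -(g (0, 0, 1)).2.2.1, ?_⟩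
    have := congrArg (fun z => z.2.2.1) h
    simp [Cfg.E, Cfg.Eq, Cfg.Ep, Cfg.Ed, Cfg.θ] at this
    linear_combination (norm := noncomm_ring) this

variable {K : Type u} [Field K] {κ χ : K} {p : Polynomial K}

local notation "𝔸" => GeneralizedWeylAlgebra K κ χ p

open Polynomial MulOpposite

/-- The twisted representation. -/
noncomputable def grep' (hκ : κ ≠ 0) :
    GeneralizedWeylAlgebra K κ χ p →ₐ[K] Module.End K (ℤ → K[X]) :=
  glift (grep hκ (ga K κ χ p)) (κ • grep hκ (gx K κ χ p)) (κ⁻¹ • grep hκ (gy K κ χ p))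
    (by
      rw [smul_mul_smul_comm, inv_mul_cancel₀ hκ, one_smul, ← map_mul, gyx,
        Polynomial.aeval_algHom_apply])
    (by
      rw [smul_mul_smul_comm, mul_inv_cancel₀ hκ, one_smul, ← map_mul, gxy,
        ← Polynomial.aeval_algHom_apply, map_add, map_smul, AlgHom.commutes])
    (by
      rw [smul_mul_assoc, ← map_mul, gxa, map_mul, map_add, map_smul, AlgHom.commutes,
        mul_smul_comm])
    (by
      rw [smul_mul_assoc, ← map_mul, gya, map_mul, map_smul, map_sub, AlgHom.commutes,
        mul_smul_comm])

/-- The bilinear pairing. -/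
noncomputable def Lam (hκ : κ ≠ 0) : (𝔸 ⊗[K] 𝔸ᵐᵒᵖ) →ₗ[K] Module.End K (ℤ → K[X]) :=
  TensorProduct.lift (LinearMap.mk₂ K
    (fun u w => grep hκ (unop w) * shift K K[X] 1 * grep' hκ u)
    (fun u u' w => by rw [map_add, mul_add])
    (fun r u w => by rw [map_smul, mul_smul_comm])
    (fun u w w' => by rw [unop_add, map_add, add_mul, add_mul])
    (fun r u w => by rw [unop_smul, map_smul, smul_mul_assoc, smul_mul_assoc]))

theorem Lam_tmul (hκ : κ ≠ 0) (u w : 𝔸) : Lam hκ (u ⊗ₜ op w) =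
    grep hκ w * shift K K[X] 1 * grep' hκ u := by
  rw [Lam, TensorProduct.lift.tmul]; rfl

theorem Lam_mul (hκ : κ ≠ 0) (z t : 𝔸 ⊗[K] 𝔸ᵐᵒᵖ) (hz : Lam hκ z = 0) : Lam hκ (z * t) = 0 := by
  induction t using TensorProduct.induction_on with
  | zero => rw [mul_zero, map_zero]
  | add t t' h h' => rw [mul_add, map_add, h, h', add_zero]
  | tmul u w =>
    induction w using MulOpposite.rec' with
    | _ w =>
    have : ∀ z, Lam hκ (z * (u ⊗ₜ[K] op w)) = grep hκ w * Lam hκ z * grep' hκ u := by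
      intro z
      induction z using TensorProduct.induction_on with
      | zero => rw [zero_mul, map_zero, mul_zero, zero_mul]
      | add t t' h h' => rw [add_mul, map_add, h, h', map_add, mul_add, add_mul]
      | tmul u' w' =>
        induction w' using MulOpposite.rec' with
        | _ w' =>
        rw [Algebra.TensorProduct.tmul_mul_tmul, ← op_mul, Lam_tmul, Lam_tmul, map_mul, map_mul]
        simp only [mul_assoc]
    rw [this, hz, mul_zero, zero_mul]

theorem grep_y (hκ : κ ≠ 0) : grep hκ (gy K κ χ p) = shift K K[X] (-1) := by
  rw [grep, wrep, glift_y]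

theorem shift_mul (k l : ℤ) : shift K K[X] k * shift K K[X] l = shift K K[X] (k + l) := by
  ext F n : 2
  simp [add_assoc]

theorem Lam_g1 (hκ : κ ≠ 0) : Lam hκ ((cfg K κ χ p hκ).y * (cfg K κ χ p hκ).k -
    (cfg K κ χ p hκ).y') = 0 := by
  have e1 : (cfg K κ χ p hκ).y = gy K κ χ p ⊗ₜ op 1 := rfl
  have e2 : (cfg K κ χ p hκ).y' = 1 ⊗ₜ op (gy K κ χ p) := rfl
  rw [mul_k, map_sub, map_smul, e1, e2, Lam_tmul, Lam_tmul, map_one, map_one, one_mul, mul_one,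
    grep', glift_y, mul_smul_comm, smul_smul, mul_inv_cancel₀ hκ, one_smul, grep_y, shift_mul,
    shift_mul, add_comm, sub_self]

theorem Lam_g2 (hκ : κ ≠ 0) : Lam hκ ((cfg K κ χ p hκ).ev ((cfg K κ χ p hκ).π₂
    (cfg K κ χ p hκ).d)) = 0 := by
  rw [cfg_pd', ← op_one, map_sub, Lam_tmul, Lam_tmul, map_one, map_one, one_mul, mul_one,
    grep', glift_a, map_add, AlgHom.commutes, map_smul, sub_eq_zero]
  ext F n : 2
  simp only [Module.End.mul_apply, shift_apply, LinearMap.add_apply, LinearMap.smul_apply,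
    Pi.add_apply, Pi.smul_apply, Module.algebraMap_end_apply, grep, wrep_a]
  rw [gl_succ, add_smul, smul_assoc, algebraMap_smul]

theorem grep'_aeval (hκ : κ ≠ 0) (f : K[X]) : grep' hκ (aeval (ga K κ χ p) f) =
    grep hκ (aeval (ga K κ χ p) f) := by
  rw [← Polynomial.aeval_algHom_apply, ← Polynomial.aeval_algHom_apply, grep', glift_a]

theorem eq_zero_of_grep (hκ : κ ≠ 0) (f : K[X]) (hf : grep hκ (aeval (ga K κ χ p) f) = 0) :
    f = 0 := by
  by_contra h
  have := congrFun (congrArg (fun t => t (fun _ => 1)) hf) 0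
  simp only [grep, wrep_aeval, LinearMap.zero_apply, Pi.zero_apply, smul_eq_mul, mul_one] at this
  exact aeval_gl_ne hκ 0 h this

theorem no_retract (hκ : κ ≠ 0) {a b : K[X]} (h : a * p + b * derivative p = 1) {h3}
    (g : ((𝔸 ⊗[K] 𝔸ᵐᵒᵖ) × (𝔸 ⊗[K] 𝔸ᵐᵒᵖ) × (𝔸 ⊗[K] 𝔸ᵐᵒᵖ)) →ₗ[𝔸 ⊗[K] 𝔸ᵐᵒᵖ]
      ((𝔸 ⊗[K] 𝔸ᵐᵒᵖ) × (𝔸 ⊗[K] 𝔸ᵐᵒᵖ) × (𝔸 ⊗[K] 𝔸ᵐᵒᵖ) × (𝔸 ⊗[K] 𝔸ᵐᵒᵖ)))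
    (hg : ∀ v, g ((cfg K κ χ p hκ).D v) = (cfg K κ χ p hκ).E (b ⊗ₜ 1) (a ⊗ₜ 1) h3 v) :
    False := by
  obtain ⟨⟨s, t, hst⟩, ⟨s', t', hst'⟩⟩ := (cfg K κ χ p hκ).ideal_mem g hg
  have z : ∀ s t, Lam hκ (((cfg K κ χ p hκ).y * (cfg K κ χ p hκ).k -
    (cfg K κ χ p hκ).y') * s + (cfg K κ χ p hκ).ev ((cfg K κ χ p hκ).π₂
    (cfg K κ χ p hκ).d) * t) = 0 := fun s t => by
    rw [map_add, Lam_mul hκ _ _ (Lam_g1 hκ), Lam_mul hκ _ _ (Lam_g2 hκ), add_zero]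
  have e : ∀ f : K[X], (cfg K κ χ p hκ).ev ((cfg K κ χ p hκ).π₂ (f ⊗ₜ 1)) =
      aeval (ga K κ χ p) f ⊗ₜ 1 := fun f => by simp [cfg]
  have e1 : (cfg K κ χ p hκ).y * (cfg K κ χ p hκ).y' = gy K κ χ p ⊗ₜ op (gy K κ χ p) := by
    simp [cfg]
  have e2 : (cfg K κ χ p hκ).y' = 1 ⊗ₜ op (gy K κ χ p) := rfl
  have hs1 : shift K K[X] (-1) * shift K K[X] 1 = 1 := by
    rw [shift_mul]; ext F n : 2; simp
  have hs2 : shift K K[X] (-1) * shift K K[X] 1 = 1 := by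
    rw [shift_mul]; ext F n : 2; simp
  have q1 := congrArg (Lam hκ) hst
  have q2 := congrArg (Lam hκ) hst'
  rw [z, e, e1, Algebra.TensorProduct.tmul_mul_tmul, one_mul, Lam_tmul, grep_y, hs1, one_mul,
    map_mul, grep'_aeval, grep', glift_y, mul_smul_comm, smul_eq_zero] at q1
  rw [z, e, e2, Algebra.TensorProduct.tmul_mul_tmul, one_mul, mul_one, Lam_tmul, grep_y, hs1,
    one_mul, grep'_aeval] at q2
  have hb := eq_zero_of_grep hκ b q2
  have ha : a = 0 := by
    apply eq_zero_of_grep (κ := κ) (χ := χ) (p := p) hκ a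
    have := congrArg (· * shift K K[X] 1) (q1.resolve_left (inv_ne_zero hκ))
    simpa [mul_assoc, grep_y, hs1] using this
  rw [ha, hb] at h
  simp at h

attribute [local instance] modA

theorem ker_μm_proj (h : HasFGProjBimoduleResolutionOfLength K (GeneralizedWeylAlgebra K κ χ p) 1) :
    Module.Projective (𝔸 ⊗[K] 𝔸ᵐᵒᵖ) (LinearMap.ker (μm K κ χ p)) := by
  obtain ⟨P, d, ε, -, hP, hε, h0, h, hs⟩ := h
  have := pdLT_of_res 1 𝔸 P d ε hP hε h0 h hs
  rw [pdLT_ker_iff (μm K κ χ p) μm_surjective, pdLT_one_iff] at this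
  exact this

theorem not_length_one (hκ : κ ≠ 0) (hp : p ≠ 0) {a b : K[X]} (h : a * p + b * derivative p = 1) :
    ¬ HasFGProjBimoduleResolutionOfLength K (GeneralizedWeylAlgebra K κ χ p) 1 := by
  intro hr
  have hpr := ker_μm_proj hr
  obtain ⟨h3, h'⟩ := bezout (κ := κ) (χ := χ) hκ h
  obtain ⟨s, hsE, hs⟩ := (cfg K κ χ p hκ).exists_section h' (cfg_ht0 hκ hp) (cfg_htp hκ hp)
    (cfg_ht2 hκ hp)
  let d' := (cfg K κ χ p hκ).d₁.codRestrict (LinearMap.ker (μm K κ χ p)) (μm_d₁ hκ)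
  have hd' : Function.Surjective d' := by
    rintro ⟨y, hy⟩
    obtain ⟨x, hx⟩ := (exact_d₁_μm hκ y).1 hy
    exact ⟨x, Subtype.ext hx⟩
  obtain ⟨σ, hσ⟩ := Module.projective_lifting_property d' LinearMap.id hd'
  have hr : ∀ m, m - σ (d' m) ∈ LinearMap.range (cfg K κ χ p hκ).D := by
    intro m
    refine (exact_D_d₁ hκ _).1 ?_
    rw [map_sub, sub_eq_zero]
    have := congrArg Subtype.val (LinearMap.congr_fun hσ (d' m))
    exact this.symm
  let ρ := (LinearMap.id - σ ∘ₗ d').codRestrict (LinearMap.range (cfg K κ χ p hκ).D) hr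
  refine no_retract hκ h (h3 := h3) (s ∘ₗ ρ) (fun v => ?_)
  rw [← hsE, LinearMap.comp_apply]
  congr 1
  apply Subtype.ext
  have : d' ((cfg K κ χ p hκ).D v) = 0 := Subtype.ext ((cfg K κ χ p hκ).d₁_D v)
  change (cfg K κ χ p hκ).D v - σ (d' ((cfg K κ χ p hκ).D v)) = (cfg K κ χ p hκ).D v
  rw [this, map_zero, sub_zero]

end NoLengthOne


section Obstruction

theorem Cfg.obstr {S T V V' : Type*} [Ring S] [CommRing T] [AddCommGroup V] [Module S V]
    [AddCommGroup V'] [Module S V'] (c : Cfg S T) (hproj : Module.Projective S (LinearMap.range c.D))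
    (f : V →ₗ[S] V') (hf : Function.Surjective f) (e : V')
    (he : ∀ v, c.D v = 0 → v.2.2.1 • e = 0) :
    ∃ c1 c2 c3 : V, f c3 = e ∧ c.y • c1 + c.x' • c2 = c.ev c.d • c3 := by
  let g : (S × S × S × S) →ₗ[S] V' := (LinearMap.toSpanSingleton S V' e) ∘ₗ
    LinearMap.fst S S S ∘ₗ LinearMap.snd S S (S × S) ∘ₗ LinearMap.snd S S (S × S × S)
  have hg : ∀ v, g v = v.2.2.1 • e := fun v => rfl
  obtain ⟨s, hs⟩ := exists_factor c.D g he
  obtain ⟨t, ht⟩ := Module.projective_lifting_property f s hf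
  let G := t ∘ₗ c.D.rangeRestrict
  refine ⟨G (1, 0, 0, 0), G (0, 1, 0, 0), G (0, 0, 1, 0), ?_, ?_⟩
  · have := LinearMap.congr_fun ht (c.D.rangeRestrict (0, 0, 1, 0))
    rw [hs, hg, one_smul] at this
    exact this
  · rw [← sub_eq_zero, ← map_smul, ← map_smul, ← map_smul, ← map_add, ← map_sub]
    have h0 : c.D (c.y • (1, 0, 0, 0) + c.x' • (0, 1, 0, 0) - c.ev c.d • (0, 0, 1, 0)) = 0 := by
      have e1 := c.hy c.d
      have e2 := c.hx' c.d
      have e3 := c.q0t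
      have e4 : c.ev c.d * c.ev c.q = c.ev c.q * c.ev c.d := by
        rw [← map_mul, mul_comm, map_mul]
      simp only [Prod.smul_mk, smul_eq_mul, mul_one, mul_zero, Prod.mk_add_mk, add_zero, zero_add,
        Prod.mk_sub_mk, sub_zero, zero_sub, Cfg.D_apply]
      refine Prod.ext ?_ (Prod.ext ?_ ?_)
      · change _ = (0 : S)
        linear_combination (norm := noncomm_ring) e3 + e4 + c.yx' * c.k
      · change _ = (0 : S)
        linear_combination (norm := noncomm_ring) e1
      · change _ = (0 : S)
        linear_combination (norm := noncomm_ring) e2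
    have h1 : c.D.rangeRestrict (c.y • (1, 0, 0, 0) + c.x' • (0, 1, 0, 0) - c.ev c.d • (0, 0, 1, 0))
        = 0 := Subtype.ext h0
    change t _ = 0
    rw [h1, map_zero]

variable {K : Type u} [Field K] {κ χ : K} {p : Polynomial K}

local notation "𝔸" => GeneralizedWeylAlgebra K κ χ p

open Polynomial MulOpposite

variable (χ p) in
/-- The anti-automorphism swapping the two generators. -/
noncomputable def tau (hκ : κ ≠ 0) :
    (GeneralizedWeylAlgebra K κ χ p)ᵐᵒᵖ →ₐ[K] GeneralizedWeylAlgebra K κ χ p :=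
  AlgHom.opComm (glift (op (ga K κ χ p)) (op (gy K κ χ p)) (op (gx K κ χ p))
    (by rw [← op_mul, gyx, aeval_op'])
    (by
      rw [← op_mul, gxy, ← aeval_op', op_add, op_smul]; rfl)
    (by
      have : κ • op (ga K κ χ p) + algebraMap K 𝔸ᵐᵒᵖ χ =
        op (κ • (ga K κ χ p) + algebraMap K 𝔸 χ) := rfl
      rw [this, ← op_mul, ← op_mul, gya' hκ])
    (by
      have : κ⁻¹ • (op (ga K κ χ p) - algebraMap K 𝔸ᵐᵒᵖ χ) =
        op (κ⁻¹ • ((ga K κ χ p) - algebraMap K 𝔸 χ)) := rfl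
      rw [this, ← op_mul, ← op_mul, mul_smul_comm, mul_sub, gxa, ← Algebra.commutes χ, add_mul,
        add_sub_cancel_right, smul_mul_assoc, smul_smul, inv_mul_cancel₀ hκ, one_smul]))

theorem tau_a (hκ : κ ≠ 0) : tau χ p hκ (op (ga K κ χ p)) = ga K κ χ p := by
  change unop (glift _ _ _ _ _ _ _ (ga K κ χ p)) = _
  rw [glift_a]; rfl
theorem tau_x (hκ : κ ≠ 0) : tau χ p hκ (op (gx K κ χ p)) = gy K κ χ p := by
  change unop (glift _ _ _ _ _ _ _ (gx K κ χ p)) = _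
  rw [glift_x]; rfl
theorem tau_y (hκ : κ ≠ 0) : tau χ p hκ (op (gy K κ χ p)) = gx K κ χ p := by
  change unop (glift _ _ _ _ _ _ _ (gy K κ χ p)) = _
  rw [glift_y]; rfl

/-- Pointwise action on families. -/
def fam (K V : Type*) [Field K] [AddCommGroup V] [Module K V] :
    Module.End K V →ₐ[K] Module.End K (ℤ → V) :=
  AlgHom.ofLinearMap
    { toFun := fun T =>
        { toFun := fun F n => T (F n)
          map_add' := fun F G => by ext n; simp
          map_smul' := fun r F => by ext n; simp }
      map_add' := fun l m => by ext F n; simp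
      map_smul' := fun r l => by ext F n; simp }
    (by ext F n; simp) (fun l m => by ext F n; simp)

theorem fam_apply {K V : Type*} [Field K] [AddCommGroup V] [Module K V] (T : Module.End K V)
    (F : ℤ → V) (n : ℤ) : fam K V T F n = T (F n) := rfl

section

variable {C : Type*} [CommRing C] [Algebra K C]

variable (χ) in
/-- Weights starting from `t` at index one. -/
noncomputable def lw (hκ : κ ≠ 0) (t : C) (n : ℤ) : C := ((aff hκ χ) ^ (n - 1)) t

theorem lw_succ (hκ : κ ≠ 0) (t : C) (n : ℤ) :
    lw χ hκ t (n + 1) = κ • lw χ hκ t n + algebraMap K C χ := by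
  have := aff_zpow hκ χ t (n - 1)
  rw [sub_add_cancel] at this
  rw [lw, add_sub_cancel_right, this, lw]

theorem lw_one (hκ : κ ≠ 0) (t : C) : lw χ hκ t 1 = t := by simp [lw]

variable (χ) in
/-- Weights starting from `t` at index zero. -/
noncomputable def mw (hκ : κ ≠ 0) (t : C) (n : ℤ) : C := ((aff hκ χ) ^ n) t

theorem mw_succ (hκ : κ ≠ 0) (t : C) (n : ℤ) :
    mw χ hκ t (n + 1) = κ • mw χ hκ t n + algebraMap K C χ := aff_zpow hκ χ t n

theorem mw_zero (hκ : κ ≠ 0) (t : C) : mw χ hκ t 0 = t := by simp [mw]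

theorem aff_map {C' : Type*} [CommRing C'] [Algebra K C'] (hκ : κ ≠ 0) (φ : C →ₐ[K] C') (t : C)
    (n : ℤ) : φ (((aff hκ χ) ^ n) t) = ((aff hκ χ) ^ n) (φ t) := by
  induction n using Int.induction_on with
  | zero => simp
  | succ n ih => rw [aff_zpow, aff_zpow, map_add, map_smul, AlgHom.commutes, ih]
  | pred n ih =>
    have h1 := aff_zpow hκ χ t (-(n : ℤ) - 1)
    have h2 := aff_zpow hκ χ (φ t) (-(n : ℤ) - 1)
    rw [sub_add_cancel] at h1 h2
    rw [h1, h2, map_add, map_smul, AlgHom.commutes, add_left_inj] at ih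
    exact smul_right_injective _ hκ ih

variable (χ p) in
/-- The left representation. -/
noncomputable def Lrep (hκ : κ ≠ 0) (t : C) :
    GeneralizedWeylAlgebra K κ χ p →ₐ[K] Module.End K (ℤ → ℤ → C) :=
  wrep (ℤ → C) hκ (lw χ hκ t) (lw_succ hκ t)

variable (χ p) in
/-- The right representation. -/
noncomputable def Rrep (hκ : κ ≠ 0) (t : C) :
    (GeneralizedWeylAlgebra K κ χ p)ᵐᵒᵖ →ₐ[K] Module.End K (ℤ → ℤ → C) :=
  ((fam K (ℤ → C)).comp (wrep C hκ (mw χ hκ t) (mw_succ hκ t))).comp (tau χ p hκ)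

theorem L_a (hκ : κ ≠ 0) (t : C) (F : ℤ → ℤ → C) (n j : ℤ) :
    Lrep χ p hκ t (ga K κ χ p) F n j = lw χ hκ t n * F n j := by
  rw [Lrep, wrep_a]; rfl
theorem L_x (hκ : κ ≠ 0) (t : C) (F : ℤ → ℤ → C) (n j : ℤ) :
    Lrep χ p hκ t (gx K κ χ p) F n j = aeval (lw χ hκ t (n + 1)) p * F (n + 1) j := by
  rw [Lrep, wrep_x]; rfl
theorem L_y (hκ : κ ≠ 0) (t : C) (F : ℤ → ℤ → C) (n j : ℤ) :
    Lrep χ p hκ t (gy K κ χ p) F n j = F (n - 1) j := by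
  rw [Lrep, wrep_y]
theorem R_a (hκ : κ ≠ 0) (t : C) (F : ℤ → ℤ → C) (n j : ℤ) :
    Rrep χ p hκ t (op (ga K κ χ p)) F n j = mw χ hκ t j * F n j := by
  rw [Rrep, AlgHom.comp_apply, tau_a, AlgHom.comp_apply, fam_apply, wrep_a]; rfl
theorem R_y (hκ : κ ≠ 0) (t : C) (F : ℤ → ℤ → C) (n j : ℤ) :
    Rrep χ p hκ t (op (gy K κ χ p)) F n j = aeval (mw χ hκ t (j + 1)) p * F n (j + 1) := by
  rw [Rrep, AlgHom.comp_apply, tau_y, AlgHom.comp_apply, fam_apply, wrep_x]; rfl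
theorem R_x (hκ : κ ≠ 0) (t : C) (F : ℤ → ℤ → C) (n j : ℤ) :
    Rrep χ p hκ t (op (gx K κ χ p)) F n j = F n (j - 1) := by
  rw [Rrep, AlgHom.comp_apply, tau_x, AlgHom.comp_apply, fam_apply, wrep_y]

theorem LR_comm (hκ : κ ≠ 0) (t s : C) (u : 𝔸) (w : 𝔸ᵐᵒᵖ) :
    Commute (Lrep χ p hκ t u) (Rrep χ p hκ s w) := by
  have hR : ∀ (F : ℤ → ℤ → C) n, Rrep χ p hκ s w F n =
      wrep (p := p) C hκ (mw χ hκ s) (mw_succ hκ s) (tau χ p hκ w) (F n) := fun F n => rfl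
  induction u using ginduction with
  | h0 r => rw [AlgHom.commutes]; exact Algebra.commutes _ _
  | ha =>
    refine LinearMap.ext fun F => funext fun n => ?_
    rw [Module.End.mul_apply, Module.End.mul_apply, hR, Lrep, wrep_a, wrep_a, hR, wrep_smul]
  | hx =>
    refine LinearMap.ext fun F => funext fun n => ?_
    rw [Module.End.mul_apply, Module.End.mul_apply, hR, Lrep, wrep_x, wrep_x, hR, wrep_smul]
  | hy =>
    refine LinearMap.ext fun F => funext fun n => ?_
    rw [Module.End.mul_apply, Module.End.mul_apply, hR, Lrep, wrep_y, wrep_y, hR]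
  | hm u v hu hv => rw [map_mul]; exact hu.mul_left hv
  | hadd u v hu hv => rw [map_add]; exact hu.add_left hv

variable (χ p) in
/-- The bimodule representation. -/
noncomputable def Phi (hκ : κ ≠ 0) (t s : C) : GeneralizedWeylAlgebra K κ χ p ⊗[K]
    (GeneralizedWeylAlgebra K κ χ p)ᵐᵒᵖ →ₐ[K] Module.End K (ℤ → ℤ → C) :=
  Algebra.TensorProduct.lift (Lrep χ p hκ t) (Rrep χ p hκ s) (LR_comm hκ t s)

theorem Phi_tmul (hκ : κ ≠ 0) (t s : C) (u : 𝔸) (w : 𝔸ᵐᵒᵖ) : Phi χ p hκ t s (u ⊗ₜ w) =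
    Lrep χ p hκ t u * Rrep χ p hκ s w := rfl

theorem Phi_l (hκ : κ ≠ 0) (t s : C) (u : 𝔸) : Phi χ p hκ t s (u ⊗ₜ 1) = Lrep χ p hκ t u := by
  rw [Phi_tmul, map_one, mul_one]
theorem Phi_r (hκ : κ ≠ 0) (t s : C) (w : 𝔸ᵐᵒᵖ) :
    Phi χ p hκ t s (1 ⊗ₜ w) = Rrep χ p hκ s w := by
  rw [Phi_tmul, map_one, one_mul]

/-- Induction principle for invariance statements. -/
theorem Sind {P : 𝔸 ⊗[K] 𝔸ᵐᵒᵖ → Prop} (h0 : ∀ r : K, P (algebraMap K _ r))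
    (ha : P (ga K κ χ p ⊗ₜ 1)) (hx : P (gx K κ χ p ⊗ₜ 1)) (hy : P (gy K κ χ p ⊗ₜ 1))
    (ha' : P (1 ⊗ₜ op (ga K κ χ p))) (hx' : P (1 ⊗ₜ op (gx K κ χ p)))
    (hy' : P (1 ⊗ₜ op (gy K κ χ p)))
    (hm : ∀ u v, P u → P v → P (u * v)) (hadd : ∀ u v, P u → P v → P (u + v)) (z) : P z := by
  have h1 : ∀ u : 𝔸, P (u ⊗ₜ 1) := by
    intro u
    induction u using ginduction with
    | h0 r => exact h0 r
    | ha => exact ha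
    | hx => exact hx
    | hy => exact hy
    | hm u v hu hv =>
      have := hm _ _ hu hv
      rwa [Algebra.TensorProduct.tmul_mul_tmul, mul_one] at this
    | hadd u v hu hv => rw [add_tmul]; exact hadd _ _ hu hv
  have h2 : ∀ u : 𝔸, P (1 ⊗ₜ op u) := by
    intro u
    induction u using ginduction with
    | h0 r =>
      have : (1 : 𝔸) ⊗ₜ[K] op (algebraMap K 𝔸 r) = algebraMap K _ r := by
        rw [Algebra.TensorProduct.algebraMap_apply, Algebra.algebraMap_eq_smul_one, op_smul,
          op_one, tmul_smul, smul_tmul']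
      rw [this]; exact h0 r
    | ha => exact ha'
    | hx => exact hx'
    | hy => exact hy'
    | hm u v hu hv =>
      have := hm _ _ hv hu
      rwa [Algebra.TensorProduct.tmul_mul_tmul, mul_one, ← op_mul] at this
    | hadd u v hu hv => rw [op_add, tmul_add]; exact hadd _ _ hu hv
  induction z using TensorProduct.induction_on with
  | zero => simpa using h0 0
  | add u v hu hv => exact hadd _ _ hu hv
  | tmul u w =>
    have := hm _ _ (h1 u) (h2 (unop w))
    rwa [Algebra.TensorProduct.tmul_mul_tmul, mul_one, one_mul, op_unop] at this

theorem Phi_vanish (hκ : κ ≠ 0) (t s : C) (ht : aeval t p = 0) (hs : aeval s p = 0)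
    (z : 𝔸 ⊗[K] 𝔸ᵐᵒᵖ) : ∀ F : ℤ → ℤ → C, (∀ n j, n ≤ 0 ∨ j < 0 → F n j = 0) →
    ∀ n j, n ≤ 0 ∨ j < 0 → Phi χ p hκ t s z F n j = 0 := by
  induction z using Sind with
  | h0 r =>
    intro F hF n j h
    rw [AlgHom.commutes, Module.algebraMap_end_apply, Pi.smul_apply, Pi.smul_apply, hF n j h,
      smul_zero]
  | ha => intro F hF n j h; rw [Phi_l, L_a, hF n j h, mul_zero]
  | hx =>
    intro F hF n j h
    rw [Phi_l, L_x]
    by_cases hn : n = 0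
    · rw [hn, zero_add, lw_one, ht, zero_mul]
    · rw [hF, mul_zero]; omega
  | hy => intro F hF n j h; rw [Phi_l, L_y, hF]; omega
  | ha' => intro F hF n j h; rw [Phi_r, R_a, hF n j h, mul_zero]
  | hx' => intro F hF n j h; rw [Phi_r, R_x, hF]; omega
  | hy' =>
    intro F hF n j h
    rw [Phi_r, R_y]
    by_cases hn : j = -1
    · rw [hn, neg_add_cancel, mw_zero, hs, zero_mul]
    · rw [hF, mul_zero]; omega
  | hm u v hu hv => intro F hF; rw [map_mul]; exact hu _ (hv F hF)
  | hadd u v hu hv =>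
    intro F hF n j h
    rw [map_add, LinearMap.add_apply, Pi.add_apply, Pi.add_apply, hu F hF n j h, hv F hF n j h,
      add_zero]

theorem Phi_map {C' : Type*} [CommRing C'] [Algebra K C'] (hκ : κ ≠ 0) (φ : C →ₐ[K] C') (t s : C)
    (z : 𝔸 ⊗[K] 𝔸ᵐᵒᵖ) : ∀ (F : ℤ → ℤ → C) n j,
    Phi χ p hκ (φ t) (φ s) z (fun n j => φ (F n j)) n j = φ (Phi χ p hκ t s z F n j) := by
  have hl : ∀ n, lw χ hκ (φ t) n = φ (lw χ hκ t n) := fun n => (aff_map hκ φ t _).symm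
  have hm : ∀ n, mw χ hκ (φ s) n = φ (mw χ hκ s n) := fun n => (aff_map hκ φ s _).symm
  induction z using Sind with
  | h0 r =>
    intro F n j
    rw [AlgHom.commutes, AlgHom.commutes, Module.algebraMap_end_apply, Module.algebraMap_end_apply,
      Pi.smul_apply, Pi.smul_apply, Pi.smul_apply, Pi.smul_apply, map_smul]
  | ha => intro F n j; rw [Phi_l, Phi_l, L_a, L_a, hl, map_mul]
  | hx =>
    intro F n j
    rw [Phi_l, Phi_l, L_x, L_x, hl, map_mul, Polynomial.aeval_algHom_apply]
  | hy => intro F n j; rw [Phi_l, Phi_l, L_y, L_y]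
  | ha' => intro F n j; rw [Phi_r, Phi_r, R_a, R_a, hm, map_mul]
  | hx' => intro F n j; rw [Phi_r, Phi_r, R_x, R_x]
  | hy' =>
    intro F n j
    rw [Phi_r, Phi_r, R_y, R_y, hm, map_mul, Polynomial.aeval_algHom_apply]
  | hm u v hu hv =>
    intro F n j
    rw [map_mul, map_mul, Module.End.mul_apply, Module.End.mul_apply, ← hu]
    have : (Phi χ p hκ (φ t) (φ s) v fun n j => φ (F n j)) =
        fun n j => φ (Phi χ p hκ t s v F n j) := funext fun n => funext fun j => hv F n j
    rw [this]
  | hadd u v hu hv =>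
    intro F n j
    rw [map_add, map_add, LinearMap.add_apply, LinearMap.add_apply, Pi.add_apply, Pi.add_apply,
      Pi.add_apply, Pi.add_apply, hu, hv, map_add]

end

end Obstruction


section Backward

variable {K : Type u} [Field K] {κ χ : K} {p : Polynomial K}

local notation "𝔸" => GeneralizedWeylAlgebra K κ χ p

open Polynomial MulOpposite

/-- The families vanishing outside of a quadrant. -/
def Van (S C : Type*) [Ring S] [CommRing C] [Module S (ℤ → ℤ → C)]
    (h : ∀ (z : S) (F : ℤ → ℤ → C), (∀ n j, n ≤ 0 ∨ j < 0 → F n j = 0) →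
      ∀ n j, n ≤ 0 ∨ j < 0 → (z • F) n j = 0) : Submodule S (ℤ → ℤ → C) where
  carrier := {F | ∀ n j, n ≤ 0 ∨ j < 0 → F n j = 0}
  add_mem' {F G} hF hG n j hnj := by
    rw [Pi.add_apply, Pi.add_apply, hF n j hnj, hG n j hnj, add_zero]
  zero_mem' n j _ := rfl
  smul_mem' z F hF := h z F hF

/-- Reduction of coefficients on families. -/
def redn {S C C' : Type*} [Ring S] [CommRing C] [CommRing C'] [Module S (ℤ → ℤ → C)]
    [Module S (ℤ → ℤ → C')] (h) (h') (φ : C →+* C')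
    (hφ : ∀ (z : S) (F : ℤ → ℤ → C),
      z • (fun n j => φ (F n j)) = fun n j => φ ((z • F) n j)) :
    Van S C h →ₗ[S] Van S C' h' where
  toFun F := ⟨fun n j => φ (F.1 n j), fun n j hnj => by
    change φ (F.1 n j) = 0
    rw [F.2 n j hnj, map_zero]⟩
  map_add' F G := by
    apply Subtype.ext
    funext n j
    exact map_add φ _ _
  map_smul' z F := Subtype.ext (hφ z F.1).symm

theorem range_D_proj (hκ : κ ≠ 0)
    (h : HasFGProjBimoduleResolutionOfLength K (GeneralizedWeylAlgebra K κ χ p) 2) :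
    Module.Projective (𝔸 ⊗[K] 𝔸ᵐᵒᵖ) (LinearMap.range (cfg K κ χ p hκ).D) := by
  letI := modA K κ χ p
  obtain ⟨P, d, ε, -, hP, hε, h0, h, hs⟩ := h
  have := pdLT_of_res 2 𝔸 P d ε hP hε h0 h hs
  rw [pdLT_ker_iff (μm K κ χ p) μm_surjective] at this
  let d' := (cfg K κ χ p hκ).d₁.codRestrict (LinearMap.ker (μm K κ χ p)) (μm_d₁ hκ)
  have hd' : Function.Surjective d' := by
    rintro ⟨y, hy⟩
    obtain ⟨x, hx⟩ := (exact_d₁_μm hκ y).1 hy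
    exact ⟨x, Subtype.ext hx⟩
  rw [pdLT_ker_iff d' hd', pdLT_one_iff] at this
  have hk : LinearMap.ker d' = LinearMap.range (cfg K κ χ p hκ).D := by
    exact (LinearMap.ker_codRestrict _ _ _).trans (exact_D_d₁ hκ).linearMap_ker_eq
  rwa [hk] at this

theorem eps_mul_ne_zero (z : DualNumber K) (hz : TrivSqZeroExt.fstHom K K K z = 1) :
    DualNumber.eps * z ≠ 0 := by
  intro h
  have h9 := congrArg TrivSqZeroExt.snd h
  have hc9 : TrivSqZeroExt.fst z = 1 := hz
  rw [TrivSqZeroExt.snd_mul, hc9] at h9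
  simp at h9

theorem no_root (hκ : κ ≠ 0) (α : K) (hα : (X - C α) ^ 2 ∣ p)
    (hproj : Module.Projective (𝔸 ⊗[K] 𝔸ᵐᵒᵖ) (LinearMap.range (cfg K κ χ p hκ).D)) : False := by
  let τ : DualNumber K := algebraMap K _ α + DualNumber.eps
  let σ : DualNumber K := algebraMap K _ α
  let φ : DualNumber K →ₐ[K] K := TrivSqZeroExt.fstHom K K K
  have hφτ : φ τ = α := by
    change φ (algebraMap K (DualNumber K) α + DualNumber.eps) = α
    rw [map_add, AlgHom.commutes]
    change α + 0 = α
    rw [add_zero]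
  have hφσ : φ σ = α := φ.commutes α
  obtain ⟨r, hr⟩ := hα
  have hτ : aeval τ p = 0 := by
    rw [hr, map_mul, map_pow, map_sub, aeval_X, aeval_C, add_sub_cancel_left, pow_two,
      DualNumber.eps_mul_eps, zero_mul]
  have hσ : aeval σ p = 0 := by
    rw [hr, map_mul, map_pow, map_sub, aeval_X, aeval_C, sub_self, zero_pow two_ne_zero, zero_mul]
  have hα : aeval α p = 0 := by
    rw [hr, map_mul, map_pow, map_sub, aeval_X, aeval_C, Algebra.algebraMap_self_apply, sub_self,
      zero_pow two_ne_zero, zero_mul]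
  letI m1 : Module (𝔸 ⊗[K] 𝔸ᵐᵒᵖ) (ℤ → ℤ → DualNumber K) :=
    Module.compHom _ (Phi χ p hκ τ σ).toRingHom
  letI m2 : Module (𝔸 ⊗[K] 𝔸ᵐᵒᵖ) (ℤ → ℤ → K) :=
    Module.compHom _ (Phi χ p hκ α α).toRingHom
  have s1 : ∀ (z : 𝔸 ⊗[K] 𝔸ᵐᵒᵖ) (F : ℤ → ℤ → DualNumber K), z • F = Phi χ p hκ τ σ z F :=
    fun _ _ => rfl
  have s2 : ∀ (z : 𝔸 ⊗[K] 𝔸ᵐᵒᵖ) (F : ℤ → ℤ → K), z • F = Phi χ p hκ α α z F :=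
    fun _ _ => rfl
  have v1 := fun z => Phi_vanish (χ := χ) (p := p) hκ τ σ hτ hσ z
  have v2 := fun z => Phi_vanish (χ := χ) (p := p) hκ α α hα hα z
  let f := redn (S := 𝔸 ⊗[K] 𝔸ᵐᵒᵖ) v1 v2 φ.toRingHom (fun z F => by
    funext n j
    have := Phi_map (χ := χ) (p := p) hκ φ τ σ z F n j
    rw [hφτ, hφσ] at this
    exact this)
  have hf : Function.Surjective f := by
    intro G
    refine ⟨⟨fun n j => algebraMap K _ (G.1 n j), fun n j h => by
      change algebraMap K (DualNumber K) (G.1 n j) = 0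
      rw [G.2 n j h, map_zero]⟩, ?_⟩
    apply Subtype.ext
    funext n j
    exact φ.commutes _
  let e' : ℤ → ℤ → K := fun n j => if n = 0 ∧ j = 0 then 1 else 0
  let e : Van (𝔸 ⊗[K] 𝔸ᵐᵒᵖ) K v2 := ⟨fun n j => if n = 1 ∧ j = 0 then 1 else 0, fun n j h =>
    if_neg (by omega)⟩
  have h1 : (cfg K κ χ p hκ).y • e' = e.1 := by
    change Phi χ p hκ α α (gy K κ χ p ⊗ₜ 1) e' = _
    funext n j
    rw [Phi_l, L_y]
    simp only [e', e, sub_eq_zero]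
  have h2 : (cfg K κ χ p hκ).y' • e' = 0 := by
    change Phi χ p hκ α α (1 ⊗ₜ op (gy K κ χ p)) e' = _
    funext n j
    rw [Phi_r, R_y]
    by_cases hj : j + 1 = 0
    · rw [hj, mw_zero, hα, zero_mul]; rfl
    · simp only [e', hj, and_false, if_false, mul_zero]; rfl
  have h3 : (cfg K κ χ p hκ).ev ((cfg K κ χ p hκ).π₁ (cfg K κ χ p hκ).d) • e' = 0 := by
    rw [cfg_pd, s2, map_sub, Phi_l, Phi_r]
    funext n j
    rw [map_add, map_smul, AlgHom.commutes]
    simp only [LinearMap.sub_apply, LinearMap.add_apply, LinearMap.smul_apply, Pi.sub_apply,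
      Pi.add_apply, Pi.smul_apply, L_a, R_a, Module.algebraMap_end_apply, Pi.zero_apply]
    by_cases hj : n = 0 ∧ j = 0
    · have := lw_succ (χ := χ) hκ α 0
      rw [zero_add, lw_one] at this
      simp only [Algebra.algebraMap_self_apply, smul_eq_mul] at this
      simp only [e', hj, and_self, if_true, mw_zero, mul_one, smul_eq_mul, ← this, sub_self]
    · simp [e', hj]
  obtain ⟨c1, c2, c3, hc, hrel⟩ := Cfg.obstr (V := Van (𝔸 ⊗[K] 𝔸ᵐᵒᵖ) (DualNumber K) v1)
    (V' := Van (𝔸 ⊗[K] 𝔸ᵐᵒᵖ) K v2) (cfg K κ χ p hκ) hproj f hf e (by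
    intro v hv
    apply Subtype.ext
    change v.2.2.1 • e.1 = 0
    have h := congrArg (fun z => z.2.1) hv
    simp only [Cfg.D_apply] at h
    have h' := congrArg (fun z => z • e') h
    simp only [add_smul, mul_smul, h1, h2, h3, smul_zero, zero_add, add_zero] at h'
    exact h'.trans (zero_smul (𝔸 ⊗[K] 𝔸ᵐᵒᵖ) e'))
  have hrel' := congrFun (congrFun (congrArg Subtype.val hrel) 1) 0
  have hy : ((cfg K κ χ p hκ).y • c1.1) 1 0 = 0 := by
    change Phi χ p hκ τ σ (gy K κ χ p ⊗ₜ 1) c1.1 1 0 = _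
    rw [Phi_l, L_y]
    exact c1.2 _ _ (by omega)
  have hx' : ((cfg K κ χ p hκ).x' • c2.1) 1 0 = 0 := by
    change Phi χ p hκ τ σ (1 ⊗ₜ op (gx K κ χ p)) c2.1 1 0 = _
    rw [Phi_r, R_x]
    exact c2.2 _ _ (by omega)
  have hd : ((cfg K κ χ p hκ).ev (cfg K κ χ p hκ).d • c3.1) 1 0 = DualNumber.eps * c3.1 1 0 := by
    rw [cfg_d, s1, map_sub, Phi_l, Phi_r]
    simp only [LinearMap.sub_apply, Pi.sub_apply, L_a, R_a, lw_one, mw_zero]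
    rw [← sub_mul, add_sub_cancel_left]
  have hc' : φ (c3.1 1 0) = 1 := by
    have := congrFun (congrFun (congrArg Subtype.val hc) 1) 0
    exact this.trans (if_pos (e := (0 : K)) (⟨rfl, rfl⟩ : (1 : ℤ) = 1 ∧ (0 : ℤ) = 0))
  have hfin : (DualNumber.eps : DualNumber K) * c3.1 1 0 = 0 := by
    rw [← hd]
    refine hrel'.symm.trans ?_
    change ((cfg K κ χ p hκ).y • c1.1) 1 0 + ((cfg K κ χ p hκ).x' • c2.1) 1 0 = 0
    rw [hy, hx', add_zero]
  exact eps_mul_ne_zero _ hc' hfin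

theorem exists_double_root [IsAlgClosed K] (hp : p ≠ 0) (h : ¬ Squarefree p) :
    ∃ α : K, (X - C α) ^ 2 ∣ p := by
  unfold Squarefree at h
  push Not at h
  obtain ⟨d, hd, hu⟩ := h
  have hd0 : d ≠ 0 := by
    rintro rfl
    rw [zero_mul, zero_dvd_iff] at hd
    exact hp hd
  obtain ⟨α, hα⟩ := IsAlgClosed.exists_root d (fun h => hu (Polynomial.isUnit_iff_degree_eq_zero.2 h))
  refine ⟨α, dvd_trans ?_ hd⟩
  rw [pow_two]
  exact mul_dvd_mul (dvd_iff_isRoot.2 hα) (dvd_iff_isRoot.2 hα)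

theorem main [IsAlgClosed K] [CharZero K] (κ χ : K) (hκ : κ ≠ 0) (p : K[X]) (hp : p ≠ 0) :
    (HasFGProjBimoduleResolutionOfLength K (GeneralizedWeylAlgebra K κ χ p) 2 ∧
      ¬ HasFGProjBimoduleResolutionOfLength K (GeneralizedWeylAlgebra K κ χ p) 1)
    ↔ Squarefree p := by
  constructor
  · rintro ⟨h, -⟩
    by_contra hs
    obtain ⟨α, hα⟩ := exists_double_root hp hs
    exact no_root hκ α hα (range_D_proj hκ h)
  · intro hs
    obtain ⟨a, b, hab⟩ := PerfectField.separable_iff_squarefree.2 hs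
    exact ⟨length_two hκ hp hab, not_length_one hκ hp hab⟩

end Backward

end GWAProof

/-- Over an algebraically closed field `K` of characteristic zero, for
`π(a) = κ a + χ` with `κ ≠ 0` and a nonzero polynomial `p`, the generalized Weyl algebra
`K[a](π, p)` is homologically smooth of homological dimension `2` (it admits a finitely
generated projective bimodule resolution of length `2` but none of length `1`) if and only
if `p` has no multiple roots (i.e. `p` is squarefree). -/
theorem generalizedWeylAlgebra_smooth_iff_squarefree
    (K : Type*) [Field K] [IsAlgClosed K] [CharZero K]
    (κ χ : K) (hκ : κ ≠ 0) (p : Polynomial K) (hp : p ≠ 0) :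
    (HasFGProjBimoduleResolutionOfLength K (GeneralizedWeylAlgebra K κ χ p) 2 ∧
      ¬ HasFGProjBimoduleResolutionOfLength K (GeneralizedWeylAlgebra K κ χ p) 1)
    ↔ Squarefree p := by
  exact GWAProof.main κ χ hκ p hp
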